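/- Let n ≥ 15. Then the six smallest elements of cd(S_n) \ {1}, listed in increasing order, are: d_1(S_n) = n−1, d_2(S_n) = n(n−3)/2, d_3(S_n) = (n−1)(n−2)/2, d_4(S_n) = n(n−1)(n−5)/6, d_5(S_n) = (n−1)(n−2)(n−3)/6, and d_6(S_n) = n(n−2)(n−4)/3. -/

import Mathlib

open CategoryTheory

/-- The set of degrees of irreducible complex representations of `G`. -/
noncomputable def cd (G : Type) [Group G] : Set ℕ :=
  {d | ∃ V : FDRep ℂ G, Simple V ∧ Module.finrank ℂ V = d}

/-- `dDeg G i` is the `i`-th smallest nontrivial irreducible character degree of `G`,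
i.e. the `i`-th smallest element of `cd G \ {1}` (indexed from `i = 1`). -/
noncomputable def dDeg (G : Type) [Group G] (i : ℕ) : ℕ :=
  Nat.nth (· ∈ cd G \ {1}) (i - 1)

/-- Add a box at the end of row `i`. -/
def addBox (r : ℕ → ℕ) (i : ℕ) : ℕ → ℕ := fun j => r j + if j = i then 1 else 0

/-- Remove a box from the end of row `i`. -/
def removeBox (r : ℕ → ℕ) (i : ℕ) : ℕ → ℕ := fun j => r j - if j = i then 1 else 0

/-- The number of standard Young tableaux whose shape has `n` boxes and row lengths `r`, computed
by removing corners. -/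
def numTableaux : ℕ → (ℕ → ℕ) → ℕ
  | 0, _ => 1
  | n + 1, r => ∑ i ∈ (Finset.range (n + 1)).filter (fun i => r (i + 1) < r i),
      numTableaux n (removeBox r i)

/-- `IsTableau n r c` says that `c 0, …, c (n - 1)` are the contents of the successive boxes of a
standard Young tableau whose shape has row lengths `r`. -/
def IsTableau : ℕ → (ℕ → ℕ) → (ℕ → ℂ) → Prop
  | 0, r, _ => r = 0
  | n + 1, r, c => Antitone r ∧ ∃ q i, r = addBox q i ∧ IsTableau n q c ∧
      c n = ((q i - i : ℤ) : ℂ)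

/-- `IsShape n r` says that `r` is the sequence of row lengths of a Young diagram with `n` boxes. -/
def IsShape (n : ℕ) (r : ℕ → ℕ) : Prop :=
  Antitone r ∧ (∀ i, n ≤ i → r i = 0) ∧ ∑ i ∈ Finset.range n, r i = n

theorem addBox_apply (q : ℕ → ℕ) (i j : ℕ) :
    addBox q i j = q j + if j = i then 1 else 0 := rfl

theorem removeBox_apply (q : ℕ → ℕ) (i j : ℕ) :
    removeBox q i j = q j - if j = i then 1 else 0 := rfl

theorem addBox_removeBox {r : ℕ → ℕ} {i : ℕ} (h : 0 < r i) :
    addBox (removeBox r i) i = r := by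
  funext j
  rw [addBox_apply, removeBox_apply]
  split_ifs with hj
  · subst hj; omega
  · omega

theorem antitone_removeBox {r : ℕ → ℕ} (hr : Antitone r) {i : ℕ} (h : r (i + 1) < r i) :
    Antitone (removeBox r i) := by
  refine antitone_nat_of_succ_le fun j => ?_
  have : r (j + 1) ≤ r j := hr (Nat.le_succ j)
  rw [removeBox_apply, removeBox_apply]
  split_ifs with h1 h2 h2
  · omega
  · omega
  · subst h2; omega
  · omega

namespace IsShape

theorem sum_range {n : ℕ} {r : ℕ → ℕ} (h : IsShape n r) {M : ℕ} (hM : n ≤ M) :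
    ∑ i ∈ Finset.range M, r i = n := by
  rw [← h.2.2]
  refine (Finset.sum_subset (by simpa using hM) fun i _ hi => h.2.1 i ?_).symm
  simpa using hi

theorem of_sum {n M : ℕ} {r : ℕ → ℕ} (hr : Antitone r) (h0 : ∀ i, M ≤ i → r i = 0)
    (hs : ∑ i ∈ Finset.range M, r i = n) : IsShape n r := by
  have hz : ∀ i, n ≤ i → r i = 0 := by
    intro i hi
    by_contra hne
    have hiM : i < M := by
      by_contra hc
      exact hne (h0 i (by omega))
    have h1 : ∑ j ∈ Finset.range (i + 1), 1 ≤ ∑ j ∈ Finset.range (i + 1), r j := by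
      refine Finset.sum_le_sum fun j hj => ?_
      have := hr (show j ≤ i by simp at hj; omega)
      omega
    have h2 : ∑ j ∈ Finset.range (i + 1), r j ≤ ∑ j ∈ Finset.range M, r j :=
      Finset.sum_le_sum_of_subset (by simp; omega)
    simp at h1
    omega
  refine ⟨hr, hz, ?_⟩
  conv_rhs => rw [← hs]
  rcases le_total n M with h | h
  · refine Finset.sum_subset (by simpa using h) fun i _ hi => hz i ?_
    simpa using hi
  · refine (Finset.sum_subset (by simpa using h) fun i _ hi => h0 i ?_).symm
    simpa using hi

protected theorem removeBox {n : ℕ} {r : ℕ → ℕ} (h : IsShape (n + 1) r) {i : ℕ} (hi : r (i + 1) < r i) :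
    IsShape n (removeBox r i) := by
  have hin : i < n + 1 := by
    by_contra hc
    have := h.2.1 i (by omega)
    omega
  refine of_sum (M := n + 1) (antitone_removeBox h.1 hi) (fun j hj => ?_) ?_
  · rw [removeBox_apply, h.2.1 j hj]; simp
  · have h1 : ∑ j ∈ Finset.range (n + 1), addBox (removeBox r i) i j = n + 1 := by
      rw [addBox_removeBox (by omega)]; exact h.2.2
    simp only [addBox_apply, Finset.sum_add_distrib, Finset.sum_ite_eq', Finset.mem_range,
      hin, if_true] at h1
    omega

protected theorem addBox {n : ℕ} {r : ℕ → ℕ} (h : IsShape n r) {i : ℕ}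
    (hi : Antitone (addBox r i)) : IsShape (n + 1) (addBox r i) := by
  refine of_sum (M := n + 1 + i) hi (fun j hj => ?_) ?_
  · rw [addBox_apply, h.2.1 j (by omega), if_neg (by omega)]
  · simp only [addBox_apply, Finset.sum_add_distrib, Finset.sum_ite_eq', Finset.mem_range]
    rw [h.sum_range (by omega), if_pos (by omega)]

theorem exists_corner {n : ℕ} {r : ℕ → ℕ} (h : IsShape (n + 1) r) : ∃ i, r (i + 1) < r i := by
  by_contra! hc
  have h0 : r = 0 := by
    funext i
    have : ∀ k, r i ≤ r (i + k) := by
      intro k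
      induction k with
      | zero => exact le_rfl
      | succ k ih => exact ih.trans (hc _)
    have h1 := this (n + 1)
    rw [h.2.1 (i + (n + 1)) (by omega)] at h1
    exact Nat.le_zero.1 h1
  have := h.2.2
  simp [h0] at this

theorem numTableaux_eq {n : ℕ} {r : ℕ → ℕ} (h : IsShape (n + 1) r) (S : Finset ℕ)
    (hS : ∀ i, i ∈ S ↔ r (i + 1) < r i) :
    numTableaux (n + 1) r = ∑ i ∈ S, numTableaux n (removeBox r i) := by
  rw [numTableaux]
  refine Finset.sum_congr ?_ fun _ _ => rfl
  ext i
  simp only [Finset.mem_filter, Finset.mem_range, hS, and_iff_right_iff_imp]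
  intro hi
  by_contra hc
  have := h.2.1 i (by omega)
  omega

/-- Any set of corners gives a lower bound for the number of tableaux. -/
theorem sum_le_numTableaux {n : ℕ} {r : ℕ → ℕ} (h : IsShape (n + 1) r) (S : Finset ℕ)
    (hS : ∀ i ∈ S, r (i + 1) < r i) :
    ∑ i ∈ S, numTableaux n (removeBox r i) ≤ numTableaux (n + 1) r := by
  rw [numTableaux]
  refine Finset.sum_le_sum_of_subset fun i hi => ?_
  simp only [Finset.mem_filter, Finset.mem_range]
  refine ⟨?_, hS i hi⟩
  by_contra hc
  have := h.2.1 i (by omega)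
  have := hS i hi
  omega

theorem numTableaux_pos {n : ℕ} {r : ℕ → ℕ} (h : IsShape n r) : 0 < numTableaux n r := by
  induction n generalizing r with
  | zero => simp [numTableaux]
  | succ n ih =>
    obtain ⟨i, hi⟩ := h.exists_corner
    have h1 := h.sum_le_numTableaux {i} (by simpa using hi)
    rw [Finset.sum_singleton] at h1
    exact (ih (h.removeBox hi)).trans_le h1

end IsShape

namespace IsTableau

theorem isShape {n : ℕ} {r : ℕ → ℕ} {c : ℕ → ℂ} (h : IsTableau n r c) : IsShape n r := by
  induction n generalizing r with
  | zero =>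
    rw [IsTableau] at h
    subst h
    exact ⟨antitone_const, fun _ _ => rfl, by simp⟩
  | succ n ih =>
    obtain ⟨ha, q, i, rfl, hq, -⟩ := h
    exact (ih hq).addBox ha

theorem congr {n : ℕ} {r : ℕ → ℕ} {c c' : ℕ → ℂ} (h : IsTableau n r c)
    (hc : ∀ k < n, c k = c' k) : IsTableau n r c' := by
  induction n generalizing r with
  | zero => exact h
  | succ n ih =>
    obtain ⟨ha, q, i, rfl, hq, hi⟩ := h
    exact ⟨ha, q, i, rfl, ih hq fun k hk => hc k (by omega), by rw [← hc n (by omega), hi]⟩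

theorem content_injective {q : ℕ → ℕ} (hq : Antitone q) {i j : ℕ}
    (h : (q i - i : ℤ) = q j - j) : i = j := by
  rcases lt_trichotomy i j with hij | hij | hij
  · have := hq hij.le; omega
  · exact hij
  · have := hq hij.le; omega

theorem unique {n : ℕ} {r r' : ℕ → ℕ} {c : ℕ → ℂ} (h : IsTableau n r c)
    (h' : IsTableau n r' c) : r = r' := by
  induction n generalizing r r' with
  | zero => rw [IsTableau] at h h'; rw [h, h']
  | succ n ih =>
    obtain ⟨ha, q, i, rfl, hq, hi⟩ := h
    obtain ⟨ha', q', i', rfl, hq', hi'⟩ := h'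
    obtain rfl := ih hq hq'
    rw [hi] at hi'
    obtain rfl := content_injective hq.isShape.1 (Int.cast_injective hi')
    rfl

end IsTableau

section JucysMurphy

variable {G V : Type*} [Group G] [AddCommGroup V] [Module ℂ V]

/-- The span of the orbit of a vector under a subgroup. -/
def orbitSpan (ρ : Representation ℂ G V) (K : Subgroup G) (u : V) : Submodule ℂ V :=
  Submodule.span ℂ (Set.range fun h : K => ρ h u)

theorem orbitSpan_le {ρ : Representation ℂ G V} {K : Subgroup G} {u : V} {W : Submodule ℂ V}
    (h : ∀ g ∈ K, ρ g u ∈ W) : orbitSpan ρ K u ≤ W := by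
  refine Submodule.span_le.2 ?_
  rintro _ ⟨g, rfl⟩
  exact h g g.2

theorem apply_mem_orbitSpan (ρ : Representation ℂ G V) {K : Subgroup G} (u : V) {g : G}
    (hg : g ∈ K) : ρ g u ∈ orbitSpan ρ K u :=
  Submodule.subset_span ⟨⟨g, hg⟩, rfl⟩

theorem self_mem_orbitSpan (ρ : Representation ℂ G V) (K : Subgroup G) (u : V) :
    u ∈ orbitSpan ρ K u := by
  simpa using apply_mem_orbitSpan ρ u K.one_mem

theorem apply_mem_orbitSpan_of_mem {ρ : Representation ℂ G V} {K : Subgroup G} {u v : V} {g : G}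
    (hg : g ∈ K) (hv : v ∈ orbitSpan ρ K u) : ρ g v ∈ orbitSpan ρ K u := by
  have : orbitSpan ρ K u ≤ (orbitSpan ρ K u).comap (ρ g) := orbitSpan_le fun h hh => by
    rw [Submodule.mem_comap, ← Module.End.mul_apply, ← map_mul]
    exact apply_mem_orbitSpan ρ u (K.mul_mem hg hh)
  exact this hv

theorem orbitSpan_le_of_mem {ρ : Representation ℂ G V} {K L : Subgroup G} (hKL : K ≤ L) {u v : V}
    (hv : v ∈ orbitSpan ρ L u) : orbitSpan ρ K v ≤ orbitSpan ρ L u :=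
  orbitSpan_le fun _ hg => apply_mem_orbitSpan_of_mem (hKL hg) hv

/-- `u` is a common eigenvector of `X 0, …, X (n - 1)` with eigenvalues `c 0, …, c (n - 1)`. -/
def IsWeightVector (X : ℕ → Module.End ℂ V) (n : ℕ) (c : ℕ → ℂ) (u : V) : Prop :=
  u ≠ 0 ∧ ∀ k < n, X k u = c k • u

/-- The properties of the chain of subgroups `H k` of permutations of the first `k` letters, the
simple transpositions `s k` and the Jucys-Murphy operators `X k` of a representation of a
symmetric group on `N` letters which determine its weight vectors. -/
structure JucysMurphySystem (ρ : Representation ℂ G V) (N : ℕ) (H : ℕ → Subgroup G) (s : ℕ → G)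
    (X : ℕ → Module.End ℂ V) : Prop where
  subgroup_zero : H 0 = ⊥
  subgroup_one : H 1 = ⊥
  mono : Monotone H
  sq (k : ℕ) : s k * s k = 1
  mem {k : ℕ} : k + 1 < N → s k ∈ H (k + 2)
  comm {k : ℕ} : k + 1 < N → ∀ h ∈ H k, s k * h = h * s k
  braid {k : ℕ} : k + 2 < N → s k * s (k + 1) * s k = s (k + 1) * s k * s (k + 1)
  coset {k : ℕ} : k + 1 < N → ∀ g ∈ H (k + 2),
    g ∈ H (k + 1) ∨ ∃ h ∈ H (k + 1), ∃ h' ∈ H (k + 1), g = h * s k * h'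
  op_zero : 0 < N → X 0 = 0
  op_succ {k : ℕ} : k + 1 < N → ∀ u, X (k + 1) u = ρ (s k) (X k (ρ (s k) u)) + ρ (s k) u
  op_comm {k : ℕ} : k < N → ∀ h ∈ H k, ∀ u, X k (ρ h u) = ρ h (X k u)
  op_comm_swap {j k : ℕ} : j < k → k + 1 < N → ∀ u, X j (ρ (s k) u) = ρ (s k) (X j u)
  eq_zero_of_eq {k : ℕ} : k + 1 < N → ∀ (a : ℤ) (u : V),
    X k u = (a : ℂ) • u → X (k + 1) u = (a : ℂ) • u → u = 0
  swap_eq_self {k : ℕ} : k + 1 < N → ∀ (a : ℤ) (u : V),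
    X k u = (a : ℂ) • u → X (k + 1) u = ((a + 1 : ℤ) : ℂ) • u → ρ (s k) u = u
  swap_eq_neg {k : ℕ} : k + 1 < N → ∀ (a : ℤ) (u : V),
    X k u = (a : ℂ) • u → X (k + 1) u = ((a - 1 : ℤ) : ℂ) • u → ρ (s k) u = -u

namespace JucysMurphySystem

variable {ρ : Representation ℂ G V} {N : ℕ} {H : ℕ → Subgroup G} {s : ℕ → G}
  {X : ℕ → Module.End ℂ V}

theorem swap_swap (J : JucysMurphySystem ρ N H s X) (k : ℕ) (u : V) :
    ρ (s k) (ρ (s k) u) = u := by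
  rw [← Module.End.mul_apply, ← map_mul, J.sq, map_one, Module.End.one_apply]

theorem op_apply_swap (J : JucysMurphySystem ρ N H s X) {k : ℕ} (hk : k + 1 < N) (u : V) :
    X k (ρ (s k) u) = ρ (s k) (X (k + 1) u) - u := by
  rw [J.op_succ hk, map_add, J.swap_swap, J.swap_swap, add_sub_cancel_right]

theorem op_succ_apply_swap (J : JucysMurphySystem ρ N H s X) {k : ℕ} (hk : k + 1 < N) (u : V) :
    X (k + 1) (ρ (s k) u) = ρ (s k) (X k u) + u := by
  rw [J.op_succ hk, J.swap_swap]

theorem op_orbitSpan (J : JucysMurphySystem ρ N H s X) {k m : ℕ} (hk : k < N) (hm : m ≤ k) {u v : V}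
    {a : ℂ} (hu : X k u = a • u) (hv : v ∈ orbitSpan ρ (H m) u) : X k v = a • v := by
  have : orbitSpan ρ (H m) u ≤ Module.End.eigenspace (X k) a := orbitSpan_le fun g hg => by
    rw [Module.End.mem_eigenspace_iff, J.op_comm hk g (J.mono hm hg), hu, map_smul]
  exact Module.End.mem_eigenspace_iff.1 (this hv)

/-- The vector obtained from a weight vector by exchanging its weights at `k` and `k + 1`. -/
theorem isWeightVector_swap (J : JucysMurphySystem ρ N H s X) {k : ℕ} (hk : k + 1 < N) {u : V}
    {c : ℕ → ℂ} (hu : IsWeightVector X (k + 2) c u) (h0 : c (k + 1) ≠ c k)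
    (h1 : (c (k + 1) - c k) ^ 2 ≠ 1) {e : ℕ → ℂ} (he : ∀ j < k, e j = c j) (hek : e k = c (k + 1))
    (hek' : e (k + 1) = c k) :
    IsWeightVector X (k + 2) e (ρ (s k) u - (c (k + 1) - c k)⁻¹ • u) := by
  have hne : c (k + 1) - c k ≠ 0 := sub_ne_zero.2 h0
  have hxk := hu.2 k (by omega)
  have hxk' := hu.2 (k + 1) (by omega)
  refine ⟨fun h => ?_, fun j hj => ?_⟩
  · have h2 : ρ (s k) u = (c (k + 1) - c k)⁻¹ • u := sub_eq_zero.1 h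
    have h3 := J.swap_swap k u
    rw [h2, map_smul, h2, smul_smul] at h3
    have h4 : ((c (k + 1) - c k)⁻¹ * (c (k + 1) - c k)⁻¹ - 1) • u = 0 := by
      rw [sub_smul, h3, one_smul, sub_self]
    rcases smul_eq_zero.1 h4 with h5 | h5
    · apply h1
      field_simp at h5
      linear_combination -h5
    · exact hu.1 h5
  · rcases (by omega : j < k ∨ j = k ∨ j = k + 1) with hjk | rfl | rfl
    · rw [map_sub, map_smul, J.op_comm_swap hjk hk, hu.2 j (by omega), he j hjk, map_smul]
      module
    · rw [map_sub, map_smul, J.op_apply_swap hk, hxk, hxk', hek, map_smul]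
      match_scalars
      · ring
      · field_simp
        ring
    · rw [map_sub, map_smul, J.op_succ_apply_swap hk, hxk, hxk', hek', map_smul]
      match_scalars
      · ring
      · field_simp
        ring

/-- There is no weight of the form `(…, a, a ± 1, a, …)` with three consecutive such entries. -/
theorem not_braid_pattern (J : JucysMurphySystem ρ N H s X) {k : ℕ} (hk : k + 2 < N) {u : V}
    (hu : u ≠ 0) (h : ρ (s k) u = u ∧ ρ (s (k + 1)) u = -u ∨
      ρ (s k) u = -u ∧ ρ (s (k + 1)) u = u) : False := by
  have hb : ρ (s k) (ρ (s (k + 1)) (ρ (s k) u)) =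
      ρ (s (k + 1)) (ρ (s k) (ρ (s (k + 1)) u)) := by
    simp only [← Module.End.mul_apply, ← map_mul]
    rw [← mul_assoc, ← mul_assoc, J.braid hk]
  have h2 : u + u ≠ 0 := by
    rw [← two_smul ℂ]
    exact smul_ne_zero two_ne_zero hu
  rcases h with ⟨h, h'⟩ | ⟨h, h'⟩
  · rw [h, h', map_neg, h, map_neg, h', neg_neg, neg_eq_iff_add_eq_zero] at hb
    exact h2 hb
  · rw [h, h', map_neg, h', h, map_neg, map_neg, h', h, neg_neg] at hb
    exact h2 (by nth_rewrite 1 [hb]; simp)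

end JucysMurphySystem

end JucysMurphy

theorem removeBox_addBox (q : ℕ → ℕ) (i : ℕ) : removeBox (addBox q i) i = q := by
  funext j
  rw [removeBox_apply, addBox_apply]
  omega

theorem removeBox_addBox_comm (q : ℕ → ℕ) {i j : ℕ} (h : i ≠ j) :
    removeBox (addBox q j) i = addBox (removeBox q i) j := by
  funext k
  rw [removeBox_apply, addBox_apply, addBox_apply, removeBox_apply]
  split_ifs <;> omega


theorem finrank_biSup_of_le_eigenspace {V ι : Type*} [AddCommGroup V] [Module ℂ V]
    [FiniteDimensional ℂ V] (f : Module.End ℂ V) (a : ι → ℂ) (p : ι → Submodule ℂ V)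
    (S : Finset ι) (ha : Set.InjOn a S) (hp : ∀ i ∈ S, p i ≤ f.eigenspace (a i)) :
    Module.finrank ℂ (⨆ i ∈ S, p i : Submodule ℂ V) = ∑ i ∈ S, Module.finrank ℂ (p i) := by
  classical
  induction S using Finset.induction_on with
  | empty => simp
  | insert j S hj ih =>
    rw [Finset.iSup_insert, Finset.sum_insert hj, ← ih (ha.mono (by simp)) fun i hi => hp i (by
      simp [hi]), ← Submodule.finrank_sup_add_finrank_inf_eq]
    have hd : Disjoint (p j) (⨆ i ∈ S, p i) := by
      have hx : a j ∉ a '' (S : Set ι) := by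
        rintro ⟨i, hi, hij⟩
        have := ha (by simp [Finset.mem_coe.1 hi]) (by simp) hij
        exact hj (this ▸ Finset.mem_coe.1 hi)
      refine (f.eigenspaces_iSupIndep.disjoint_biSup hx).mono (hp j (by simp)) ?_
      refine iSup₂_le fun i hi => (hp i (by simp [hi])).trans ?_
      exact le_biSup (fun μ => f.eigenspace μ) ⟨i, hi, rfl⟩
    rw [hd.eq_bot, finrank_bot, add_zero]

namespace JucysMurphySystem

variable {G V : Type*} [Group G] [AddCommGroup V] [Module ℂ V]
  {ρ : Representation ℂ G V} {N : ℕ} {H : ℕ → Subgroup G} {s : ℕ → G}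
  {X : ℕ → Module.End ℂ V}

/-- Branching: the module generated by a weight vector under `H (n + 1)` is the sum, over the
corners of the shape of its weight, of modules generated by weight vectors under `H n`. -/
theorem exists_corner_vectors (J : JucysMurphySystem ρ N H s X) {n : ℕ} (hn : n + 1 ≤ N)
    {r : ℕ → ℕ} {c : ℕ → ℂ} {u : V} (ht : IsTableau (n + 1) r c)
    (hu : IsWeightVector X (n + 1) c u) :
    ∃ w : ℕ → V, (∀ i, r (i + 1) < r i → ∃ e, IsTableau n (removeBox r i) e ∧
      e n = ((r i - 1 - i : ℤ) : ℂ) ∧ IsWeightVector X (n + 1) e (w i)) ∧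
      orbitSpan ρ (H (n + 1)) u = ⨆ i, ⨆ _ : r (i + 1) < r i, orbitSpan ρ (H n) (w i) := by
  induction n generalizing r c u with
  | zero =>
    obtain ⟨ha, q, i0, rfl, hq, hc⟩ := ht
    rw [IsTableau] at hq
    subst hq
    have h0 : i0 = 0 := by
      have h1 := ha (Nat.zero_le i0)
      simp only [addBox_apply, Pi.zero_apply, if_true] at h1
      split_ifs at h1 <;> omega
    subst h0
    refine ⟨fun _ => u, fun i hi => ?_, ?_⟩
    · have hi0 : i = 0 := by
        simp only [addBox_apply, Pi.zero_apply] at hi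
        split_ifs at hi <;> omega
      subst hi0
      refine ⟨c, ?_, ?_, hu⟩
      · rw [removeBox_addBox, IsTableau]
      · rw [hc]
        simp [addBox_apply]
    · rw [zero_add, J.subgroup_zero, J.subgroup_one]
      refine le_antisymm ?_ (iSup₂_le fun _ _ => le_rfl)
      exact le_iSup₂_of_le 0 (by simp [addBox_apply]) le_rfl
  | succ n ih =>
    obtain ⟨ha, q, i0, rfl, hq, hc⟩ := ht
    have hqa := hq.isShape.1
    have hN : n + 1 < N := by omega
    obtain ⟨w', hw', horb⟩ := ih (by omega) hq ⟨hu.1, fun k hk => hu.2 k (by omega)⟩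
    have hmem : ∀ i, q (i + 1) < q i → w' i ∈ orbitSpan ρ (H (n + 1)) u := fun i hi => by
      rw [horb]
      exact le_iSup₂ (f := fun i (_ : q (i + 1) < q i) => orbitSpan ρ (H n) (w' i)) i hi
        (self_mem_orbitSpan _ _ _)
    have hlast : ∀ i, q (i + 1) < q i → X (n + 1) (w' i) = c (n + 1) • w' i := fun i hi =>
      J.op_orbitSpan hN le_rfl (hu.2 _ (by omega)) (hmem i hi)
    have hcor : ∀ i, i ≠ i0 → addBox q i0 (i + 1) < addBox q i0 i → q (i + 1) < q i := by
      intro i hi h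
      simp only [addBox_apply, if_neg hi] at h
      omega
    set W := ⨆ i, ⨆ _ : addBox q i0 (i + 1) < addBox q i0 i, orbitSpan ρ (H (n + 1))
      (if i = i0 then u else
        ρ (s n) (w' i) - (c (n + 1) - ((q i - 1 - i : ℤ) : ℂ))⁻¹ • w' i) with hW
    refine ⟨fun i => if i = i0 then u else
      ρ (s n) (w' i) - (c (n + 1) - ((q i - 1 - i : ℤ) : ℂ))⁻¹ • w' i, fun i hi => ?_, ?_⟩
    · by_cases hii : i = i0
      · subst hii
        refine ⟨c, by rwa [removeBox_addBox], ?_, by simpa using hu⟩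
        rw [hc]
        simp [addBox_apply]
      · obtain ⟨e, he, hen, hwe⟩ := hw' i (hcor i hii hi)
        simp only [if_neg hii]
        refine ⟨fun j => if j < n then e j else if j = n then c (n + 1) else e n, ?_, ?_, ?_⟩
        · refine ⟨antitone_removeBox ha hi, removeBox q i, i0, removeBox_addBox_comm q hii,
            he.congr fun k hk => by simp [hk], ?_⟩
          simp [hc, removeBox_apply, Ne.symm hii]
        · simp [hen, addBox_apply, hii]
        · have hz : 2 ≤ |((q i0 - i0 : ℤ) - (q i - 1 - i) : ℤ)| := by
            simp only [addBox_apply, if_neg hii] at hi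
            rcases lt_or_gt_of_ne hii with h | h
            · have h1 := ha (show i + 1 ≤ i0 from h)
              simp only [addBox_apply, if_true] at h1
              rw [abs_of_nonpos] <;> omega
            · have h1 := hqa h.le
              rw [abs_of_nonneg] <;> omega
          have hcz : c (n + 1) - e n = (((q i0 - i0 : ℤ) - (q i - 1 - i) : ℤ) : ℂ) := by
            rw [hc, hen]
            push_cast
            ring
          generalize ((q i0 - i0 : ℤ) - (q i - 1 - i) : ℤ) = z at hz hcz
          have hwe' : IsWeightVector X (n + 2)
              (fun j => if j = n + 1 then c (n + 1) else e j) (w' i) := by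
            refine ⟨hwe.1, fun k hk => ?_⟩
            by_cases hkn : k = n + 1
            · subst hkn
              simpa using hlast i (hcor i hii hi)
            · simpa [hkn] using hwe.2 k (by omega)
          rw [← hen]
          have := J.isWeightVector_swap hN hwe'
            (e := fun j => if j < n then e j else if j = n then c (n + 1) else e n)
          simp only [if_true, if_neg (show n ≠ n + 1 by omega)] at this
          refine this ?_ ?_ ?_ ?_ ?_
          · rw [← sub_ne_zero, hcz, Int.cast_ne_zero]
            intro h
            rw [h] at hz
            simp at hz
          · rw [hcz]
            norm_cast
            intro h
            nlinarith [sq_abs z]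
          · intro j hj
            simp [hj, show j ≠ n + 1 by omega]
          · simp
          · simp
    · have hle : ∀ i, addBox q i0 (i + 1) < addBox q i0 i → orbitSpan ρ (H (n + 1))
          (if i = i0 then u else
            ρ (s n) (w' i) - (c (n + 1) - ((q i - 1 - i : ℤ) : ℂ))⁻¹ • w' i) ≤ W := fun i hi =>
        le_iSup₂ (f := fun i (_ : addBox q i0 (i + 1) < addBox q i0 i) => orbitSpan ρ (H (n + 1))
          (if i = i0 then u else
            ρ (s n) (w' i) - (c (n + 1) - ((q i - 1 - i : ℤ) : ℂ))⁻¹ • w' i)) i hi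
      have huW : orbitSpan ρ (H (n + 1)) u ≤ W := by
        have := hle i0 (by have := hqa (Nat.le_succ i0); simp [addBox_apply]; omega)
        simpa using this
      refine le_antisymm ?_ (iSup₂_le fun i hi => orbitSpan_le_of_mem (J.mono (by omega)) ?_)
      · have key : ∀ g ∈ H (n + 1), ∀ i, q (i + 1) < q i → ρ g (ρ (s n) (w' i)) ∈ W := by
          intro g hg i hi
          obtain ⟨e, he, hen, hwe⟩ := hw' i hi
          have hwW : ρ g (w' i) ∈ W := huW (apply_mem_orbitSpan_of_mem hg (hmem i hi))
          have hxn := hwe.2 n (by omega)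
          have hxn' := hlast i hi
          rw [hen] at hxn
          rw [hc] at hxn'
          by_cases hii : i = i0
          · subst hii
            rwa [J.swap_eq_self hN _ _ hxn (by rw [hxn']; congr 2; ring)]
          · by_cases hri : addBox q i0 (i + 1) < addBox q i0 i
            · have h1 := hle i hri (apply_mem_orbitSpan ρ _ hg)
              rw [if_neg hii, map_sub, map_smul] at h1
              exact (Submodule.sub_mem_iff_left _ (Submodule.smul_mem _ _ hwW)).1 h1
            · have hi1 : i + 1 = i0 ∧ q i0 + 1 = q i := by
                simp only [addBox_apply, if_neg hii] at hri
                split_ifs at hri with h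
                · subst h; omega
                · omega
              obtain ⟨rfl, hq1⟩ := hi1
              rw [J.swap_eq_neg hN _ _ hxn (by rw [hxn']; congr 2; push_cast; omega), map_neg]
              exact W.neg_mem hwW
        refine orbitSpan_le fun g hg => ?_
        rcases J.coset hN g hg with hg | ⟨h, hh, h', hh', rfl⟩
        · exact huW (apply_mem_orbitSpan ρ u hg)
        · have hB : orbitSpan ρ (H (n + 1)) u ≤ W.comap (ρ (h * s n)) := by
            rw [horb]
            refine iSup₂_le fun i hi => orbitSpan_le fun g hg => ?_
            rw [Submodule.mem_comap, ← Module.End.mul_apply, ← map_mul, mul_assoc,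
              J.comm hN g hg, ← mul_assoc, map_mul, Module.End.mul_apply]
            exact key _ ((H (n + 1)).mul_mem hh (J.mono (Nat.le_succ n) hg)) i hi
          have := hB (apply_mem_orbitSpan ρ u hh')
          rwa [Submodule.mem_comap, ← Module.End.mul_apply, ← map_mul] at this
      · beta_reduce
        split_ifs with hii
        · exact self_mem_orbitSpan _ _ _
        · have h1 := orbitSpan_le_of_mem (J.mono (Nat.le_succ (n + 1)))
            (self_mem_orbitSpan ρ (H (n + 2)) u) (hmem i (hcor i hii hi))
          exact Submodule.sub_mem _ (apply_mem_orbitSpan_of_mem (J.mem hN) h1)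
            (Submodule.smul_mem _ _ h1)

theorem finrank_orbitSpan [FiniteDimensional ℂ V] (J : JucysMurphySystem ρ N H s X) {n : ℕ}
    (hn : n ≤ N) {r : ℕ → ℕ} {c : ℕ → ℂ} {u : V} (ht : IsTableau n r c)
    (hu : IsWeightVector X n c u) :
    Module.finrank ℂ (orbitSpan ρ (H n) u) = numTableaux n r := by
  induction n generalizing r c u with
  | zero =>
    have : orbitSpan ρ (H 0) u = Submodule.span ℂ {u} := by
      rw [J.subgroup_zero]
      refine le_antisymm (orbitSpan_le fun g hg => ?_) ?_
      · rw [Subgroup.mem_bot.1 hg, map_one, Module.End.one_apply]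
        exact Submodule.mem_span_singleton_self u
      · rw [Submodule.span_le, Set.singleton_subset_iff]
        exact self_mem_orbitSpan _ _ _
    rw [this, finrank_span_singleton hu.1, numTableaux]
  | succ n ih =>
    obtain ⟨w, hw, horb⟩ := J.exists_corner_vectors hn ht hu
    have hsh := ht.isShape
    set S := (Finset.range (n + 1)).filter (fun i => r (i + 1) < r i) with hS
    have hmemS : ∀ i, i ∈ S ↔ r (i + 1) < r i := fun i => by
      simp only [hS, Finset.mem_filter, Finset.mem_range, and_iff_right_iff_imp]
      intro hi
      by_contra hc
      have := hsh.2.1 i (by omega)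
      omega
    have h1 : orbitSpan ρ (H (n + 1)) u = ⨆ i ∈ S, orbitSpan ρ (H n) (w i) := by
      rw [horb]
      simp only [hmemS]
    rw [h1, finrank_biSup_of_le_eigenspace (X n) (fun i => ((r i - 1 - i : ℤ) : ℂ)), numTableaux]
    · refine Finset.sum_congr rfl fun i hi => ?_
      obtain ⟨e, he, hen, hwe⟩ := hw i ((hmemS i).1 hi)
      exact ih (by omega) he ⟨hwe.1, fun k hk => hwe.2 k (by omega)⟩
    · intro i _ j _ hij
      refine IsTableau.content_injective hsh.1 ?_
      have := Int.cast_injective hij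
      omega
    · intro i hi v hv
      obtain ⟨e, he, hen, hwe⟩ := hw i ((hmemS i).1 hi)
      rw [Module.End.mem_eigenspace_iff]
      exact J.op_orbitSpan (by omega) le_rfl (by rw [← hen]; exact hwe.2 n (by omega)) hv

end JucysMurphySystem

namespace JucysMurphySystem

variable {G V : Type*} [Group G] [AddCommGroup V] [Module ℂ V]
  {ρ : Representation ℂ G V} {N : ℕ} {H : ℕ → Subgroup G} {s : ℕ → G}
  {X : ℕ → Module.End ℂ V}

/-- A vector in one of the summands of the branching decomposition, together with the
eigenvalues of the next operators on it. -/
theorem exists_corner_vector (J : JucysMurphySystem ρ N H s X) {n : ℕ} (hn : n + 1 ≤ N)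
    {r : ℕ → ℕ} {c : ℕ → ℂ} {u : V} (ht : IsTableau (n + 1) r c)
    (hu : IsWeightVector X (n + 1) c u) {i : ℕ} (hi : r (i + 1) < r i) :
    ∃ e w, IsTableau n (removeBox r i) e ∧ IsWeightVector X (n + 1) e w ∧
      X n w = ((r i - 1 - i : ℤ) : ℂ) • w ∧
      ∀ k, n + 1 ≤ k → k < N → ∀ b : ℂ, X k u = b • u → X k w = b • w := by
  obtain ⟨w, hw, horb⟩ := J.exists_corner_vectors hn ht hu
  obtain ⟨e, he, hen, hwe⟩ := hw i hi
  refine ⟨e, w i, he, hwe, by rw [← hen]; exact hwe.2 n (by omega), fun k hk hkN b hb => ?_⟩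
  refine J.op_orbitSpan hkN hk hb ?_
  rw [horb]
  exact le_iSup₂ (f := fun i (_ : r (i + 1) < r i) => orbitSpan ρ (H n) (w i)) i hi
    (self_mem_orbitSpan _ _ _)

/-- Every weight is the sequence of contents of a standard Young tableau. -/
theorem exists_isTableau (J : JucysMurphySystem ρ N H s X) {n : ℕ} (hn : n ≤ N) {c : ℕ → ℂ}
    {u : V} (hu : IsWeightVector X n c u) : ∃ r, IsTableau n r c := by
  induction n generalizing c u with
  | zero => exact ⟨0, rfl⟩
  | succ n ih =>
  rcases n with _ | m
  · have h0 := hu.2 0 (by omega)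
    rw [J.op_zero (by omega), LinearMap.zero_apply, eq_comm, smul_eq_zero] at h0
    refine ⟨addBox 0 0, antitone_nat_of_succ_le fun j => ?_, 0, 0, rfl, rfl, ?_⟩
    · simp [addBox_apply]
    · simpa using h0.resolve_right hu.1
  obtain ⟨r, hr⟩ := ih (by omega) ⟨hu.1, fun k hk => hu.2 k (by omega)⟩
  have hra := hr.isShape.1
  suffices h : ∃ j, Antitone (addBox r j) ∧ c (m + 1) = ((r j - j : ℤ) : ℂ) by
    obtain ⟨j, hj, hcj⟩ := h
    exact ⟨addBox r j, hj, r, j, rfl, hr, hcj⟩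
  obtain ⟨i, hi⟩ := hr.isShape.exists_corner
  have hN : m + 1 < N := by omega
  obtain ⟨e, w, he, hw, hxm, hxk⟩ := J.exists_corner_vector (by omega) hr
    ⟨hu.1, fun k hk => hu.2 k (by omega)⟩ hi
  have hxm' := hxk (m + 1) le_rfl hN _ (hu.2 (m + 1) (by omega))
  have hem : e m = ((r i - 1 - i : ℤ) : ℂ) := by
    have := hw.2 m (by omega)
    rw [hxm] at this
    exact (smul_left_injective ℂ hw.1 this).symm
  have hrem : removeBox r i i = r i - 1 := by simp [removeBox_apply]
  have hpat : ∀ p, removeBox r i (p + 1) < removeBox r i p →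
      (removeBox r i p - 1 - p : ℤ) = r i - 1 - i + 1 ∧ c (m + 1) = ((r i - 1 - i + 1 : ℤ) : ℂ) ∨
      (removeBox r i p - 1 - p : ℤ) = r i - 1 - i - 1 ∧ c (m + 1) = ((r i - 1 - i - 1 : ℤ) : ℂ) →
      False := by
    intro p hp hpa
    rcases m with _ | m
    · rw [IsTableau] at he
      simp [he] at hp
    obtain ⟨e₂, w₂, -, hw₂, hx, hxk₂⟩ := J.exists_corner_vector (by omega) he
      ⟨hw.1, fun k hk => hw.2 k (by omega)⟩ hp
    have hx₁ := hxk₂ (m + 1) le_rfl (by omega) _ hxm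
    have hx₂ := hxk₂ (m + 1 + 1) (by omega) hN _ hxm'
    refine J.not_braid_pattern (k := m) (by omega) hw₂.1 ?_
    rcases hpa with ⟨h1, h2⟩ | ⟨h1, h2⟩
    · refine .inr ⟨J.swap_eq_neg (by omega) _ _ hx ?_, J.swap_eq_self hN _ _ hx₁ ?_⟩
      · rw [hx₁]; congr 2; omega
      · rw [hx₂, h2]
    · refine .inl ⟨J.swap_eq_self (by omega) _ _ hx ?_, J.swap_eq_neg hN _ _ hx₁ ?_⟩
      · rw [hx₁]; congr 2; omega
      · rw [hx₂, h2]
  have hstep : ∀ k, r (k + 1) ≤ r k := fun k => hra (Nat.le_succ k)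
  by_cases hb0 : c (m + 1) = ((r i - 1 - i : ℤ) : ℂ)
  · exact (hw.1 (J.eq_zero_of_eq hN _ w hxm (by rw [hxm', hb0]))).elim
  by_cases hb1 : c (m + 1) = ((r i - 1 - i + 1 : ℤ) : ℂ)
  · by_cases hadd : ∀ p, i = p + 1 → r i < r p
    · refine ⟨i, antitone_nat_of_succ_le fun k => ?_, by rw [hb1]; congr 1; ring⟩
      have h1 := hstep k
      have h2 := hadd k
      simp only [addBox_apply]
      split_ifs with h3 h4 h4
      · omega
      · have := h2 h3.symm; subst h3; omega
      · omega
      · omega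
    · push Not at hadd
      obtain ⟨p, rfl, hp⟩ := hadd
      have hrp : r (p + 1) = r p := le_antisymm (hstep p) hp
      have hremp : removeBox r (p + 1) p = r p := by simp [removeBox_apply]
      refine (hpat p (by rw [hrem, hremp]; omega) (.inl ⟨?_, hb1⟩)).elim
      rw [hremp]
      push_cast
      omega
  by_cases hb2 : c (m + 1) = ((r i - 1 - i - 1 : ℤ) : ℂ)
  · by_cases hadd : r i = r (i + 1) + 1
    · refine ⟨i + 1, antitone_nat_of_succ_le fun k => ?_, ?_⟩
      · have h1 := hstep k
        simp only [addBox_apply]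
        split_ifs with h3 h4 h4
        · omega
        · obtain rfl : k = i := by omega
          omega
        · omega
        · omega
      · rw [hb2, hadd]
        congr 1
        push_cast
        ring
    · have hremi : removeBox r i (i + 1) = r (i + 1) := by simp [removeBox_apply]
      refine (hpat i (by rw [hrem, hremi]; omega) (.inr ⟨?_, hb2⟩)).elim
      rw [hrem]
      omega
  have hw' : IsWeightVector X (m + 2) (fun j => if j = m + 1 then c (m + 1) else e j) w := by
    refine ⟨hw.1, fun k hk => ?_⟩
    by_cases hkn : k = m + 1
    · subst hkn
      simpa using hxm'
    · simpa [hkn] using hw.2 k (by omega)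
  have hsw := J.isWeightVector_swap hN hw'
    (e := fun j => if j < m then e j else if j = m then c (m + 1) else e m)
  simp only [if_true, if_neg (show m ≠ m + 1 by omega)] at hsw
  have hv := hsw (by rwa [hem]) (by
      rw [hem]
      intro h
      rcases mul_self_eq_one_iff.1 ((pow_two _).symm.trans h) with h | h
      · exact hb1 (by rw [sub_eq_iff_eq_add] at h; rw [h]; push_cast; ring)
      · exact hb2 (by rw [sub_eq_iff_eq_add] at h; rw [h]; push_cast; ring))
    (by intro j hj; simp [hj, show j ≠ m + 1 by omega]) (by simp) (by simp)
  obtain ⟨r', ha', q, j, rfl, hq, hcj⟩ := ih (by omega) ⟨hv.1, fun k hk => hv.2 k (by omega)⟩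
  simp only [lt_irrefl, if_false, if_true] at hcj
  obtain rfl := hq.unique (he.congr fun k hk => by simp [hk])
  have hji : j ≠ i := by
    rintro rfl
    apply hb0
    rw [hcj, hrem]
    congr 1
    omega
  have hremj : removeBox r i j = r j := by simp [removeBox_apply, hji]
  refine ⟨j, antitone_nat_of_succ_le fun k => ?_, by rw [hcj, hremj]⟩
  have h1 := hstep k
  have h2 := ha' (Nat.le_succ k)
  simp only [addBox_apply, removeBox_apply, Nat.succ_eq_add_one] at h2 ⊢
  split_ifs at h2 ⊢ <;> omega

end JucysMurphySystem

open Equiv in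
/-- The permutations of the first `k` letters. -/
def permSubgroup (N k : ℕ) : Subgroup (Perm (Fin N)) where
  carrier := {σ | ∀ i : Fin N, k ≤ i → σ i = i}
  one_mem' := fun _ _ => rfl
  mul_mem' := fun {σ τ} hσ hτ i hi => by rw [Perm.mul_apply, hτ i hi, hσ i hi]
  inv_mem' := fun {σ} hσ i hi => by rw [Perm.inv_eq_iff_eq, hσ i hi]

open Equiv in
/-- The transposition of the letters `k` and `k + 1`. -/
def simpleSwap (N k : ℕ) : Perm (Fin N) :=
  if h : k + 1 < N then swap ⟨k, by omega⟩ ⟨k + 1, h⟩ else 1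

open Equiv in
/-- The Jucys-Murphy operators. -/
def jucysMurphy {N : ℕ} {V : Type*} [AddCommGroup V] [Module ℂ V]
    (ρ : Representation ℂ (Perm (Fin N)) V) (k : ℕ) : Module.End ℂ V :=
  if h : k < N then ∑ j ∈ Finset.univ.filter (fun j : Fin N => (j : ℕ) < k),
    ρ (swap j ⟨k, h⟩) else 0

section

open Equiv

theorem exists_invariant_form {G V : Type*} [Group G] [Finite G] [AddCommGroup V] [Module ℂ V]
    [FiniteDimensional ℂ V] (ρ : Representation ℂ G V) :
    ∃ B : V →+ V →+ ℝ, (∀ x y, B x y = B y x) ∧ (∀ g x y, B (ρ g x) (ρ g y) = B x y) ∧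
      ∀ x, B x x = 0 → x = 0 := by
  have := Fintype.ofFinite G
  let b := Module.finBasis ℂ V
  let f : V → V → ℝ := fun x y => ∑ g, ∑ i,
    ((b.repr (ρ g x) i).re * (b.repr (ρ g y) i).re + (b.repr (ρ g x) i).im * (b.repr (ρ g y) i).im)
  have hsymm : ∀ x y, f x y = f y x := fun x y => by
    simp only [f, mul_comm]
  have hadd : ∀ x y z, f x (y + z) = f x y + f x z := fun x y z => by
    simp only [f, ← Finset.sum_add_distrib, map_add, Finsupp.add_apply, Complex.add_re,
      Complex.add_im]
    refine Finset.sum_congr rfl fun g _ => Finset.sum_congr rfl fun i _ => ?_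
    ring
  refine ⟨AddMonoidHom.mk' (fun x => AddMonoidHom.mk' (f x) (hadd x)) fun x y => ?_, hsymm,
    fun g x y => ?_, fun x hx => ?_⟩
  · ext z
    simp [hsymm _ z, hadd]
  · refine Fintype.sum_equiv (Equiv.mulRight g) _ _ fun h => ?_
    simp [map_mul]
  · have h1 : ∑ i, ((b.repr (ρ 1 x) i).re * (b.repr (ρ 1 x) i).re +
        (b.repr (ρ 1 x) i).im * (b.repr (ρ 1 x) i).im) = 0 := by
      refine (Finset.sum_eq_zero_iff_of_nonneg (fun g _ => ?_)).1 hx 1 (Finset.mem_univ _)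
      exact Finset.sum_nonneg fun i _ => add_nonneg (mul_self_nonneg _) (mul_self_nonneg _)
    rw [map_one, Module.End.one_apply] at h1
    refine b.repr.map_eq_zero_iff.1 (Finsupp.ext fun i => ?_)
    have h2 := (Finset.sum_eq_zero_iff_of_nonneg (fun i _ => add_nonneg (mul_self_nonneg _)
      (mul_self_nonneg _))).1 h1 i (Finset.mem_univ _)
    refine Complex.ext ?_ ?_ <;> simp only [Finsupp.zero_apply, Complex.zero_re, Complex.zero_im]
      <;> nlinarith [mul_self_nonneg (b.repr x i).re, mul_self_nonneg (b.repr x i).im]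

variable {N : ℕ} {V : Type*} [AddCommGroup V] [Module ℂ V] (ρ : Representation ℂ (Perm (Fin N)) V)

theorem simpleSwap_eq {k : ℕ} (h : k + 1 < N) :
    simpleSwap N k = swap ⟨k, by omega⟩ ⟨k + 1, h⟩ := dif_pos h

theorem simpleSwap_mul_self (N k : ℕ) : simpleSwap N k * simpleSwap N k = 1 := by
  rw [simpleSwap]
  split_ifs <;> simp

theorem simpleSwap_apply_of_ne {k : ℕ} {i : Fin N} (h : (i : ℕ) ≠ k) (h' : (i : ℕ) ≠ k + 1) :
    simpleSwap N k i = i := by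
  rw [simpleSwap]
  split_ifs
  · exact swap_apply_of_ne_of_ne (by simpa [Fin.ext_iff] using h) (by simpa [Fin.ext_iff] using h')
  · rfl

theorem permSubgroup_mono (N : ℕ) : Monotone (permSubgroup N) :=
  fun _ _ h _ hσ i hi => hσ i (h.trans hi)

theorem lt_of_mem_permSubgroup {k : ℕ} {σ : Perm (Fin N)} (hσ : σ ∈ permSubgroup N k) {i : Fin N}
    (hi : (i : ℕ) < k) : (σ i : ℕ) < k := by
  by_contra hc
  have h1 := σ.injective (hσ (σ i) (by omega))
  rw [h1] at hc
  omega

theorem jucysMurphy_apply {k : ℕ} (h : k < N) (u : V) :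
    jucysMurphy ρ k u = ∑ j ∈ Finset.univ.filter (fun j : Fin N => (j : ℕ) < k),
      ρ (swap j ⟨k, h⟩) u := by
  rw [jucysMurphy, dif_pos h, LinearMap.sum_apply]

theorem jucysMurphy_apply_perm {k : ℕ} (hk : k < N) {σ : Perm (Fin N)}
    (hσ : σ ∈ permSubgroup N k) (u : V) :
    jucysMurphy ρ k (ρ σ u) = ρ σ (jucysMurphy ρ k u) := by
  rw [jucysMurphy_apply ρ hk, jucysMurphy_apply ρ hk, map_sum]
  symm
  refine Finset.sum_equiv σ (fun j => ?_) fun j _ => ?_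
  · simp only [Finset.mem_filter, Finset.mem_univ, true_and]
    refine ⟨lt_of_mem_permSubgroup hσ, fun h => ?_⟩
    simpa using lt_of_mem_permSubgroup (inv_mem hσ) h
  · rw [← Module.End.mul_apply, ← Module.End.mul_apply, ← map_mul, ← map_mul]
    congr 2
    conv_rhs => rw [← hσ ⟨k, hk⟩ le_rfl, swap_apply_apply]
    simp

theorem jucysMurphy_comm {j k : ℕ} (h : j < k) (hk : k < N) (u : V) :
    jucysMurphy ρ k (jucysMurphy ρ j u) = jucysMurphy ρ j (jucysMurphy ρ k u) := by
  have hj : j < N := by omega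
  rw [jucysMurphy_apply ρ hj, jucysMurphy_apply ρ hj, map_sum]
  refine Finset.sum_congr rfl fun i hi => jucysMurphy_apply_perm ρ hk (fun l hl => ?_) u
  simp only [Finset.mem_filter, Finset.mem_univ, true_and] at hi
  exact swap_apply_of_ne_of_ne (by rintro rfl; omega) (by rintro rfl; simp at hl; omega)

theorem jucysMurphy_succ {k : ℕ} (hk : k + 1 < N) (u : V) :
    jucysMurphy ρ (k + 1) u = ρ (simpleSwap N k) (jucysMurphy ρ k (ρ (simpleSwap N k) u)) +
      ρ (simpleSwap N k) u := by
  have hk' : k < N := by omega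
  have hf : Finset.univ.filter (fun j : Fin N => (j : ℕ) < k + 1) =
      insert ⟨k, hk'⟩ (Finset.univ.filter (fun j : Fin N => (j : ℕ) < k)) := by
    ext j
    simp [Fin.ext_iff]
    omega
  rw [jucysMurphy_apply ρ hk, jucysMurphy_apply ρ hk', hf, Finset.sum_insert (by simp), map_sum,
    add_comm, ← simpleSwap_eq hk]
  congr 1
  refine Finset.sum_congr rfl fun j hj => ?_
  simp only [Finset.mem_filter, Finset.mem_univ, true_and] at hj
  rw [← Module.End.mul_apply, ← Module.End.mul_apply, ← map_mul, ← map_mul]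
  congr 2
  have h1 : simpleSwap N k j = j := simpleSwap_apply_of_ne (by omega) (by omega)
  have h2 : simpleSwap N k ⟨k, hk'⟩ = ⟨k + 1, hk⟩ := by rw [simpleSwap_eq hk, swap_apply_left]
  have h3 : (simpleSwap N k)⁻¹ = simpleSwap N k := inv_eq_of_mul_eq_one_left (simpleSwap_mul_self N k)
  conv_lhs => rw [← h1, ← h2, swap_apply_apply, h3]

theorem jucysMurphy_apply_simpleSwap {j k : ℕ} (hj : j < k) (hk : k + 1 < N) (u : V) :
    jucysMurphy ρ j (ρ (simpleSwap N k) u) = ρ (simpleSwap N k) (jucysMurphy ρ j u) := by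
  have hj' : j < N := by omega
  rw [jucysMurphy_apply ρ hj', jucysMurphy_apply ρ hj', map_sum]
  refine Finset.sum_congr rfl fun i hi => ?_
  simp only [Finset.mem_filter, Finset.mem_univ, true_and] at hi
  rw [← Module.End.mul_apply, ← Module.End.mul_apply, ← map_mul, ← map_mul]
  congr 2
  have h1 : simpleSwap N k i = i := simpleSwap_apply_of_ne (by omega) (by omega)
  have h2 : simpleSwap N k ⟨j, hj'⟩ = ⟨j, hj'⟩ :=
    simpleSwap_apply_of_ne (by simp; omega) (by simp; omega)
  conv_lhs => rw [← h1, ← h2, swap_apply_apply]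
  simp

theorem exists_mul_simpleSwap_mul {k : ℕ} (hk : k + 1 < N) {σ : Perm (Fin N)}
    (hσ : σ ∈ permSubgroup N (k + 2)) : σ ∈ permSubgroup N (k + 1) ∨
      ∃ h ∈ permSubgroup N (k + 1), ∃ h' ∈ permSubgroup N (k + 1),
        σ = h * simpleSwap N k * h' := by
  set p : Fin N := ⟨k + 1, hk⟩ with hp
  set m : Fin N := ⟨k, by omega⟩ with hm
  have hq : (σ p : ℕ) < k + 2 := lt_of_mem_permSubgroup hσ (by simp [hp])
  by_cases hqp : σ p = p
  · refine .inl fun i hi => ?_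
    rcases hi.lt_or_eq with hi | hi
    · exact hσ i hi
    · obtain rfl : i = p := Fin.ext hi.symm
      exact hqp
  have hq' : (σ p : ℕ) ≠ k + 1 := fun h => hqp (Fin.ext h)
  refine .inr ⟨swap m (σ p), fun i hi => ?_, simpleSwap N k * (swap m (σ p) * σ), fun i hi => ?_, ?_⟩
  · exact swap_apply_of_ne_of_ne (by rintro rfl; simp [hm] at hi) (by rintro rfl; omega)
  · rw [Perm.mul_apply, Perm.mul_apply]
    rcases hi.lt_or_eq with hi | hi
    · rw [hσ i hi, swap_apply_of_ne_of_ne (by rintro rfl; simp [hm] at hi)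
        (by rintro h; rw [h] at hi; omega), simpleSwap_apply_of_ne (by omega) (by omega)]
    · obtain rfl : i = p := Fin.ext hi.symm
      rw [swap_apply_right, simpleSwap_eq hk, swap_apply_left]
  · rw [mul_assoc, ← mul_assoc (simpleSwap N k), simpleSwap_mul_self, one_mul, ← mul_assoc,
      swap_mul_self, one_mul]

theorem simpleSwap_braid {k : ℕ} (hk : k + 2 < N) :
    simpleSwap N k * simpleSwap N (k + 1) * simpleSwap N k =
      simpleSwap N (k + 1) * simpleSwap N k * simpleSwap N (k + 1) := by
  have h3 : ∀ j, (simpleSwap N j)⁻¹ = simpleSwap N j := fun j =>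
    inv_eq_of_mul_eq_one_left (simpleSwap_mul_self N j)
  have h1 := swap_apply_apply (simpleSwap N k) ⟨k + 1, by omega⟩ ⟨k + 2, hk⟩
  have h2 := swap_apply_apply (simpleSwap N (k + 1)) ⟨k, by omega⟩ ⟨k + 1, by omega⟩
  rw [← simpleSwap_eq (k := k + 1) hk, h3] at h1
  rw [← simpleSwap_eq (k := k) (by omega), h3] at h2
  rw [← h1, ← h2, simpleSwap_eq (k := k) (by omega), simpleSwap_eq (k := k + 1) hk,
    swap_apply_right, swap_apply_of_ne_of_ne, swap_apply_of_ne_of_ne, swap_apply_left] <;>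
  simp [Fin.ext_iff, add_assoc]

theorem jucysMurphySystem [FiniteDimensional ℂ V] :
    JucysMurphySystem ρ N (permSubgroup N) (simpleSwap N) (jucysMurphy ρ) := by
  obtain ⟨B, hsymm, hinv, hdef⟩ := exists_invariant_form ρ
  have hself : ∀ k x y, B (jucysMurphy ρ k x) y = B x (jucysMurphy ρ k y) := fun k x y => by
    by_cases hk : k < N
    · rw [jucysMurphy_apply ρ hk, jucysMurphy_apply ρ hk, map_sum, map_sum,
        AddMonoidHom.finsetSum_apply]
      refine Finset.sum_congr rfl fun j _ => ?_
      rw [← hinv (swap j ⟨k, hk⟩), ← Module.End.mul_apply, ← map_mul, swap_mul_self, map_one,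
        Module.End.one_apply]
    · simp [jucysMurphy, hk]
  have hz : ∀ (a : ℤ) (x : V), (a : ℂ) • x = a • x := fun a x => Int.cast_smul_eq_zsmul ℂ a x
  have hs : ∀ k u, ρ (simpleSwap N k) (ρ (simpleSwap N k) u) = u := fun k u => by
    rw [← Module.End.mul_apply, ← map_mul, simpleSwap_mul_self, map_one, Module.End.one_apply]
  have hx : ∀ {k : ℕ}, k + 1 < N → ∀ u, jucysMurphy ρ k (ρ (simpleSwap N k) u) =
      ρ (simpleSwap N k) (jucysMurphy ρ (k + 1) u) - u := fun {k} hk u => by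
    rw [jucysMurphy_succ ρ hk, map_add, hs, hs, add_sub_cancel_right]
  -- eigenvectors of `X k` for distinct integers are orthogonal
  have horth : ∀ (k : ℕ) (a b : ℤ) (x y : V), a ≠ b → jucysMurphy ρ k x = (a : ℂ) • x →
      jucysMurphy ρ k y = (b : ℂ) • y → B x y = 0 := fun k a b x y hab hx hy => by
    have h := hself k x y
    rw [hx, hy, hz, hz, map_zsmul, map_zsmul, AddMonoidHom.zsmul_apply, zsmul_eq_mul,
      zsmul_eq_mul] at h
    have h2 : ((a : ℝ) - b) * B x y = 0 := by linear_combination h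
    exact (mul_eq_zero.1 h2).resolve_left (sub_ne_zero.2 (by exact_mod_cast hab))
  refine
    { subgroup_zero := ?_
      subgroup_one := ?_
      mono := permSubgroup_mono N
      sq := simpleSwap_mul_self N
      mem := fun {k} hk i hi => simpleSwap_apply_of_ne (by omega) (by omega)
      comm := fun {k} hk σ hσ => ?_
      braid := simpleSwap_braid
      coset := fun hk σ hσ => exists_mul_simpleSwap_mul hk hσ
      op_zero := fun h => ?_
      op_succ := fun hk => jucysMurphy_succ ρ hk
      op_comm := fun hk σ hσ => jucysMurphy_apply_perm ρ hk hσ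
      op_comm_swap := fun hj hk => jucysMurphy_apply_simpleSwap ρ hj hk
      eq_zero_of_eq := fun {k} hk a u hu hu' => ?_
      swap_eq_self := fun {k} hk a u hu hu' => ?_
      swap_eq_neg := fun {k} hk a u hu hu' => ?_ }
  · exact (Subgroup.eq_bot_iff_forall _).2 fun σ hσ => Equiv.ext fun i => hσ i (Nat.zero_le _)
  · refine (Subgroup.eq_bot_iff_forall _).2 fun σ hσ => Equiv.ext fun i => ?_
    rcases Nat.eq_zero_or_pos (i : ℕ) with h | h
    · have := lt_of_mem_permSubgroup hσ (i := i) (by omega)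
      exact Fin.ext (by simp; omega)
    · exact hσ i h
  · have h := swap_apply_apply σ ⟨k, by omega⟩ ⟨k + 1, hk⟩
    rw [hσ _ le_rfl, hσ _ (by simp), ← simpleSwap_eq hk] at h
    rw [eq_mul_inv_iff_mul_eq] at h
    exact h
  · ext u
    simp [jucysMurphy_apply ρ h]
  · have h1 := hx hk u
    rw [hu', map_smul] at h1
    have h2 := hself k (ρ (simpleSwap N k) u) u
    rw [h1, hu, hz, hz, map_sub, AddMonoidHom.sub_apply, map_zsmul, map_zsmul,
      AddMonoidHom.zsmul_apply] at h2
    exact hdef u (by linarith)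
  · have h1 := hx hk u
    rw [hu', map_smul] at h1
    have h2 : jucysMurphy ρ k (ρ (simpleSwap N k) u - u) =
        ((a + 1 : ℤ) : ℂ) • (ρ (simpleSwap N k) u - u) := by
      rw [map_sub, h1, hu]
      push_cast
      module
    have h3 := horth k _ _ _ u (by omega) h2 hu
    have h4 := hinv (simpleSwap N k) (ρ (simpleSwap N k) u - u) u
    rw [map_sub, hs] at h4
    refine sub_eq_zero.1 (hdef _ ?_)
    simp only [map_sub, AddMonoidHom.sub_apply] at *
    linarith
  · have h1 := hx hk u
    rw [hu', map_smul] at h1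
    have h2 : jucysMurphy ρ k (ρ (simpleSwap N k) u + u) =
        ((a - 1 : ℤ) : ℂ) • (ρ (simpleSwap N k) u + u) := by
      rw [map_add, h1, hu]
      push_cast
      module
    have h3 := horth k _ _ _ u (by omega) h2 hu
    have h4 := hinv (simpleSwap N k) (ρ (simpleSwap N k) u + u) u
    rw [map_add, hs] at h4
    refine eq_neg_of_add_eq_zero_left (hdef _ ?_)
    simp only [map_add, AddMonoidHom.add_apply] at *
    linarith

/-- Over `ℂ` the Jucys-Murphy operators have a common eigenvector. -/
theorem exists_isWeightVector [FiniteDimensional ℂ V] [Nontrivial V] {n : ℕ} (hn : n ≤ N) :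
    ∃ c u, IsWeightVector (jucysMurphy ρ) n c u := by
  induction n with
  | zero =>
    obtain ⟨u, hu⟩ := exists_ne (0 : V)
    exact ⟨0, u, hu, fun k hk => by omega⟩
  | succ n ih =>
    obtain ⟨c, u, hu, hk⟩ := ih (by omega)
    let W : Submodule ℂ V := ⨅ k : Fin n, (jucysMurphy ρ k).eigenspace (c k)
    have hW : ∀ v, v ∈ W ↔ ∀ k < n, jucysMurphy ρ k v = c k • v := fun v => by
      simp [W, Fin.forall_iff]
    have huW : u ∈ W := (hW u).2 hk
    have hmap : ∀ v ∈ W, jucysMurphy ρ n v ∈ W := fun v hv => (hW _).2 fun k hk => by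
      rw [← jucysMurphy_comm ρ hk (by omega), (hW v).1 hv k hk, map_smul]
    have : Nontrivial W := ⟨⟨u, huW⟩, 0, fun h => hu (congrArg Subtype.val h)⟩
    obtain ⟨b, hb⟩ := Module.End.exists_eigenvalue ((jucysMurphy ρ n).restrict hmap)
    obtain ⟨w, hw⟩ := hb.exists_hasEigenvector
    refine ⟨fun k => if k = n then b else c k, w, fun h => hw.2 (Subtype.ext h), fun k hk => ?_⟩
    by_cases hkn : k = n
    · subst hkn
      simpa using congrArg Subtype.val hw.apply_eq_smul
    · simpa [hkn] using (hW w).1 w.2 k (by omega)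

end

section

variable {G : Type} [Group G] [Finite G]

theorem simple_iff_finrank_intertwiningMap (V : FDRep ℂ G) :
    Simple V ↔ Module.finrank ℂ (Representation.IntertwiningMap (A := ℂ) V.ρ V.ρ) = 1 := by
  have : NeZero (Nat.card G : ℂ) := ⟨by exact_mod_cast Nat.card_pos.ne'⟩
  rw [FDRep.simple_iff_end_is_rank_one, ← (FDRep.forget₂HomLinearEquiv V V).finrank_eq,
    (Rep.homLinearEquiv _ _).finrank_eq]
  rfl

theorem eq_top_of_simple (V : FDRep ℂ G) (hV : Simple V) (W : Submodule ℂ V)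
    (hW : ∀ g, ∀ v ∈ W, V.ρ g v ∈ W) {u : V} (hu : u ∈ W) (hu0 : u ≠ 0) : W = ⊤ := by
  have := Fintype.ofFinite G
  obtain ⟨p, hp⟩ := W.exists_isCompl
  let π : V →ₗ[ℂ] V := W.subtype ∘ₗ W.projectionOnto p hp
  have hπ : ∀ v ∈ W, π v = v := fun v hv => by
    simpa [π] using congrArg Subtype.val (W.projectionOnto_apply_left hp ⟨v, hv⟩)
  have hπ' : ∀ v, π v ∈ W := fun v => Subtype.coe_prop _
  let P : V →ₗ[ℂ] V := ∑ g : G, V.ρ g ∘ₗ π ∘ₗ V.ρ g⁻¹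
  have hPa : ∀ v, P v = ∑ g : G, V.ρ g (π (V.ρ g⁻¹ v)) := fun v => by
    simp [P, LinearMap.sum_apply]
  have hP : ∀ (h : G) (v : V), P (V.ρ h v) = V.ρ h (P v) := fun h v => by
    rw [hPa, hPa, map_sum]
    refine Fintype.sum_equiv (Equiv.mulLeft h⁻¹) _ _ fun g => ?_
    simp only [Equiv.coe_mulLeft, mul_inv_rev, inv_inv, map_mul, Module.End.mul_apply]
    rw [← Module.End.mul_apply (V.ρ h), ← map_mul, mul_inv_cancel, map_one, Module.End.one_apply]
  let T : Representation.IntertwiningMap (A := ℂ) V.ρ V.ρ := ⟨P, fun g => LinearMap.ext (hP g)⟩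
  have h1 : (1 : Representation.IntertwiningMap (A := ℂ) V.ρ V.ρ) ≠ 0 := fun h =>
    hu0 (congrArg (fun f : Representation.IntertwiningMap (A := ℂ) V.ρ V.ρ => f u) h)
  obtain ⟨a, ha⟩ := (finrank_eq_one_iff_of_nonzero' _ h1).1
    ((simple_iff_finrank_intertwiningMap V).1 hV) T
  have ha' : ∀ v, a • v = P v := fun v =>
    congrArg (fun f : Representation.IntertwiningMap (A := ℂ) V.ρ V.ρ => f v) ha
  have ha0 : a ≠ 0 := by
    rintro rfl
    have h2 := ha' u
    have h3 : ∀ g ∈ Finset.univ, V.ρ g (π (V.ρ g⁻¹ u)) = u := fun g _ => by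
      rw [hπ _ (hW _ _ hu), ← Module.End.mul_apply, ← map_mul, mul_inv_cancel, map_one,
        Module.End.one_apply]
    rw [zero_smul, hPa, Finset.sum_congr rfl h3, Finset.sum_const, ← Nat.cast_smul_eq_nsmul ℂ,
      eq_comm, smul_eq_zero] at h2
    exact h2.elim (by simp) hu0
  refine eq_top_iff.2 fun v _ => ?_
  have h4 : P v ∈ W := by
    rw [hPa]
    exact W.sum_mem fun g _ => hW _ _ (hπ' _)
  rw [← ha' v] at h4
  exact (W.smul_mem_iff ha0).1 h4

theorem simple_of_forall_invariant {V : Type} [AddCommGroup V] [Module ℂ V]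
    [FiniteDimensional ℂ V] [Nontrivial V] (ρ : Representation ℂ G V)
    (h : ∀ W : Submodule ℂ V, (∀ g, ∀ v ∈ W, ρ g v ∈ W) → W = ⊥ ∨ W = ⊤) :
    Simple (FDRep.of ρ) := by
  have hirr : ρ.IsIrreducible :=
    { exists_pair_ne := ⟨⊥, ⊤, fun hbt => by
        obtain ⟨v, hv⟩ := exists_ne (0 : V)
        have : v ∈ (⊥ : Subrepresentation ρ).toSubmodule := by rw [hbt]; trivial
        exact hv this⟩
      eq_bot_or_eq_top := fun W => (h W.toSubmodule fun g v hv => W.apply_mem_toSubmodule g hv).imp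
        (fun hW => Subrepresentation.toSubmodule_injective hW)
        (fun hW => Subrepresentation.toSubmodule_injective hW) }
  rw [simple_iff_finrank_intertwiningMap]
  exact Representation.IsIrreducible.finrank_intertwiningMap_self ρ

end

section

open Equiv

variable {N : ℕ}

theorem map_jucysMurphy {V W : Type*} [AddCommGroup V] [Module ℂ V] [AddCommGroup W] [Module ℂ W]
    (ρ : Representation ℂ (Perm (Fin N)) V) (σ : Representation ℂ (Perm (Fin N)) W) (f : V →ₗ[ℂ] W)
    (hf : ∀ g v, f (ρ g v) = σ g (f v)) (k : ℕ) (v : V) :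
    f (jucysMurphy ρ k v) = jucysMurphy σ k (f v) := by
  by_cases hk : k < N
  · rw [jucysMurphy_apply ρ hk, jucysMurphy_apply σ hk, map_sum]
    exact Finset.sum_congr rfl fun j _ => hf _ _
  · simp [jucysMurphy, hk]

theorem permSubgroup_self (N : ℕ) : permSubgroup N N = ⊤ :=
  (Subgroup.eq_top_iff' _).2 fun _ i hi => absurd i.2 (by omega)

theorem finrank_eq_of_isWeightVector (V : FDRep ℂ (Perm (Fin N))) (hV : Simple V) {r : ℕ → ℕ}
    {c : ℕ → ℂ} {u : V} (hr : IsTableau N r c)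
    (hu : IsWeightVector (jucysMurphy (V := V) V.ρ) N c u) :
    Module.finrank ℂ V = numTableaux N r := by
  have h1 := (jucysMurphySystem (V := V) V.ρ).finrank_orbitSpan le_rfl hr hu
  rw [permSubgroup_self] at h1
  have h2 : orbitSpan (V := V) V.ρ ⊤ u = ⊤ := eq_top_of_simple V hV _
    (fun g v hv => apply_mem_orbitSpan_of_mem (Subgroup.mem_top g) hv)
    (self_mem_orbitSpan (V := V) V.ρ ⊤ u) hu.1
  rw [← h1, h2, finrank_top]

theorem exists_isShape_of_mem_cd {d : ℕ} (hd : d ∈ cd (Perm (Fin N))) :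
    ∃ r, IsShape N r ∧ numTableaux N r = d := by
  obtain ⟨V, hV, rfl⟩ := hd
  have : Nontrivial V := by
    by_contra hc
    have hs : Subsingleton V := not_nontrivial_iff_subsingleton.1 hc
    have h1 := (simple_iff_finrank_intertwiningMap V).1 hV
    have : Subsingleton (Representation.IntertwiningMap (A := ℂ) V.ρ V.ρ) :=
      ⟨fun f g => Representation.IntertwiningMap.ext (LinearMap.ext fun v => Subsingleton.elim _ _)⟩
    rw [Module.finrank_zero_of_subsingleton] at h1
    omega
  obtain ⟨c, u, hu⟩ := exists_isWeightVector (V := V) V.ρ le_rfl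
  obtain ⟨r, hr⟩ := (jucysMurphySystem (V := V) V.ρ).exists_isTableau le_rfl hu
  exact ⟨r, hr.isShape, (finrank_eq_of_isWeightVector V hV hr hu).symm⟩

/-- A weight occurring in some representation gives an irreducible representation. -/
theorem numTableaux_mem_cd {U : Type} [AddCommGroup U] [Module ℂ U] [FiniteDimensional ℂ U]
    (τ : Representation ℂ (Perm (Fin N)) U) {r : ℕ → ℕ} {c : ℕ → ℂ} {u : U}
    (hr : IsTableau N r c) (hu : IsWeightVector (jucysMurphy τ) N c u) :
    numTableaux N r ∈ cd (Perm (Fin N)) := by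
  classical
  let P : ℕ → Prop := fun d => ∃ (V : Type) (_ : AddCommGroup V) (_ : Module ℂ V)
    (_ : FiniteDimensional ℂ V) (ρ : Representation ℂ (Perm (Fin N)) V) (v : V),
    IsWeightVector (jucysMurphy ρ) N c v ∧ Module.finrank ℂ V = d
  have hex : ∃ d, P d := ⟨_, U, _, _, inferInstance, τ, u, hu, rfl⟩
  obtain ⟨V, _, _, _, ρ, v, hv, hd⟩ := Nat.find_spec hex
  have hmin : ∀ (W : Type) [AddCommGroup W] [Module ℂ W] [FiniteDimensional ℂ W]
      (σ : Representation ℂ (Perm (Fin N)) W) (w : W), IsWeightVector (jucysMurphy σ) N c w →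
      Module.finrank ℂ V ≤ Module.finrank ℂ W := fun W _ _ _ σ w hw => by
    rw [hd]
    exact Nat.find_min' hex ⟨W, _, _, inferInstance, σ, w, hw, rfl⟩
  have : Nontrivial V := ⟨v, 0, hv.1⟩
  have hs : Simple (FDRep.of ρ) := simple_of_forall_invariant ρ fun W hW => by
    by_cases hvW : v ∈ W
    · right
      let S : Subrepresentation ρ := ⟨W, hW⟩
      have h1 := hmin W S.toRepresentation ⟨v, hvW⟩ ⟨fun h => hv.1 (congrArg Subtype.val h),
        fun k hk => Subtype.ext ?_⟩
      · exact Submodule.eq_top_of_finrank_eq (le_antisymm W.finrank_le h1)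
      · exact (map_jucysMurphy S.toRepresentation ρ W.subtype (fun _ _ => rfl) k _).trans (hv.2 k hk)
    · left
      have h1 := hmin (V ⧸ W) (ρ.quotient W hW) (W.mkQ v) ⟨fun h => ?_, fun k hk => ?_⟩
      · have h2 := W.finrank_quotient_add_finrank
        exact Submodule.finrank_eq_zero.1 (by omega)
      · exact hvW (by simpa using h)
      · rw [← map_jucysMurphy ρ (ρ.quotient W hW) W.mkQ (fun _ _ => rfl), hv.2 k hk, map_smul]
  exact ⟨FDRep.of ρ, hs, finrank_eq_of_isWeightVector (FDRep.of ρ) hs hr hv⟩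

end

/-- The row lengths `a, p, q, s, 0, 0, …`. -/
def fourRows (a p q s : ℕ) : ℕ → ℕ
  | 0 => a
  | 1 => p
  | 2 => q
  | 3 => s
  | _ + 4 => 0

section

open Equiv

/-- The permutation representation on functions of `N` variables with values in a set of four
elements. -/
noncomputable def functionRep (N : ℕ) :
    Representation ℂ (Perm (Fin N)) ((Fin N → Fin 4) → ℂ) where
  toFun g := LinearMap.funLeft ℂ ℂ fun x => x ∘ g
  map_one' := rfl
  map_mul' _ _ := rfl

/-- The values of the variables, extended by zero. -/
def extendVars {N : ℕ} (x : Fin N → Fin 4) (i : ℕ) : ℂ :=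
  if h : i < N then ((x ⟨i, h⟩ : ℕ) : ℂ) else 0

theorem extendVars_comp_swap {N : ℕ} (x : Fin N → Fin 4) (i j : Fin N) :
    extendVars (x ∘ swap i j) = extendVars x ∘ swap (i : ℕ) j := by
  funext l
  by_cases hl : l < N
  · have h : ((swap i j ⟨l, hl⟩ : Fin N) : ℕ) = swap (i : ℕ) j l := by
      simp only [swap_apply_def, Fin.ext_iff]
      split_ifs <;> rfl
    have h' : swap (i : ℕ) j l < N := h ▸ Fin.is_lt _
    simp only [extendVars, Function.comp_apply, dif_pos hl, dif_pos h']
    congr 3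
    exact Fin.ext h
  · have h' : swap (i : ℕ) j l = l :=
      swap_apply_of_ne_of_ne (by rintro rfl; omega) (by rintro rfl; omega)
    simp [extendVars, hl, h']

/-- A polynomial function of the variables `x 0, …, x (m - 1)` which is a weight vector for
`S_m`, and on which the sum of all replacements of a variable by a new one is scalar, is a weight
vector for `S_N`. -/
theorem isWeightVector_functionRep {N m : ℕ} (P : (ℕ → ℂ) → ℂ) (c : ℕ → ℂ) (b : ℤ)
    (hm : m ≤ N) (hP : ∀ y z : ℕ → ℂ, (∀ i < m, y i = z i) → P y = P z)
    (hlt : ∀ k < m, ∀ y, ∑ j ∈ Finset.range k, P (y ∘ swap j k) = c k * P y)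
    (hnew : ∀ y z, ∑ j ∈ Finset.range m, P (Function.update y j z) = (m + b : ℤ) * P y)
    (hc : ∀ k, m ≤ k → c k = ((k + b : ℤ) : ℂ)) (y : ℕ → Fin 4)
    (hne : P (fun i => ((y i : ℕ) : ℂ)) ≠ 0) :
    IsWeightVector (jucysMurphy (functionRep N)) N c fun x => P (extendVars x) := by
  refine ⟨fun h => hne ?_, fun k hk => funext fun x => ?_⟩
  · refine (hP _ (extendVars fun i : Fin N => y i) fun i hi => ?_).trans
      (congrFun h fun i : Fin N => y i)
    simp [extendVars, show i < N by omega]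
  have hsum : ∀ f : ℕ → ℂ, ∑ j ∈ Finset.univ.filter (fun j : Fin N => (j : ℕ) < k), f j =
      ∑ j ∈ Finset.range k, f j := fun f => by
    refine Finset.sum_nbij (fun j : Fin N => (j : ℕ)) (fun j hj => by simpa using hj)
      (fun i _ j _ h => Fin.ext h) (fun j hj => ?_) fun _ _ => rfl
    have hj' : j < k := by simpa using hj
    exact ⟨⟨j, by omega⟩, by simpa using hj', rfl⟩
  rw [jucysMurphy_apply _ hk, Finset.sum_apply, Pi.smul_apply, smul_eq_mul]
  have h1 : ∀ j : Fin N, functionRep N (swap j ⟨k, hk⟩) (fun x => P (extendVars x)) x =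
      P (extendVars x ∘ swap (j : ℕ) k) := fun j => by
    rw [← extendVars_comp_swap x j ⟨k, hk⟩]
    rfl
  simp only [h1]
  rw [hsum fun j => P (extendVars x ∘ swap j k)]
  generalize extendVars x = z
  rcases lt_or_ge k m with hkm | hkm
  · exact hlt k hkm z
  · have h2 : ∀ j ∈ Finset.range m, P (z ∘ swap j k) = P (Function.update z j (z k)) :=
      fun j hj => hP _ _ fun i hi => by
        simp only [Finset.mem_range] at hj
        rw [Function.comp_apply, swap_apply_def, Function.update_apply]
        split_ifs <;> first | rfl | omega
    have h3 : ∀ j ∈ Finset.Ico m k, P (z ∘ swap j k) = P z := fun j hj => hP _ _ fun i hi => by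
      simp only [Finset.mem_Ico] at hj
      rw [Function.comp_apply, swap_apply_of_ne_of_ne (by omega) (by omega)]
    rw [← Finset.sum_range_add_sum_Ico _ hkm, Finset.sum_congr rfl h2, hnew,
      Finset.sum_congr rfl h3, Finset.sum_const, Nat.card_Ico, hc k hkm, nsmul_eq_mul,
      Nat.cast_sub hkm]
    push_cast
    ring

end

theorem IsTableau.addBox {n : ℕ} {q : ℕ → ℕ} {c : ℕ → ℂ} (h : IsTableau n q c) {i : ℕ}
    (hi : i = 0 ∨ q i < q (i - 1)) (hc : c n = ((q i - i : ℤ) : ℂ)) :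
    IsTableau (n + 1) (addBox q i) c := by
  refine ⟨antitone_nat_of_succ_le fun k => ?_, q, i, rfl, h, hc⟩
  have h1 := h.isShape.1 (Nat.le_succ k)
  simp only [addBox_apply, Nat.succ_eq_add_one] at h1 ⊢
  split_ifs with h3 h4 h4
  · omega
  · subst h3
    rw [Nat.add_sub_cancel] at hi
    omega
  · omega
  · omega

theorem addBox_fourRows_zero (a p q s : ℕ) :
    addBox (fourRows a p q s) 0 = fourRows (a + 1) p q s := by
  funext i; rcases i with _ | _ | _ | _ | i <;> rfl

theorem addBox_fourRows_one (a p q s : ℕ) :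
    addBox (fourRows a p q s) 1 = fourRows a (p + 1) q s := by
  funext i; rcases i with _ | _ | _ | _ | i <;> rfl

theorem addBox_fourRows_two (a p q s : ℕ) :
    addBox (fourRows a p q s) 2 = fourRows a p (q + 1) s := by
  funext i; rcases i with _ | _ | _ | _ | i <;> rfl

theorem addBox_fourRows_three (a p q s : ℕ) :
    addBox (fourRows a p q s) 3 = fourRows a p q (s + 1) := by
  funext i; rcases i with _ | _ | _ | _ | i <;> rfl

theorem isTableau_zero (c : ℕ → ℂ) : IsTableau 0 (fourRows 0 0 0 0) c := by
  rw [IsTableau]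
  funext i; rcases i with _ | _ | _ | _ | i <;> rfl

namespace IsTableau

variable {n a p q s : ℕ} {c : ℕ → ℂ}

theorem row_zero (h : IsTableau n (fourRows a p q s) c) (hc : c n = ((a : ℤ) : ℂ)) :
    IsTableau (n + 1) (fourRows (a + 1) p q s) c := by
  rw [← addBox_fourRows_zero]
  exact h.addBox (.inl rfl) (by rw [hc]; simp [fourRows])

theorem row_one (h : IsTableau n (fourRows a p q s) c) (hp : p < a)
    (hc : c n = ((p - 1 : ℤ) : ℂ)) : IsTableau (n + 1) (fourRows a (p + 1) q s) c := by
  rw [← addBox_fourRows_one]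
  exact h.addBox (.inr hp) (by rw [hc]; simp [fourRows])

theorem row_two (h : IsTableau n (fourRows a p q s) c) (hp : q < p)
    (hc : c n = ((q - 2 : ℤ) : ℂ)) : IsTableau (n + 1) (fourRows a p (q + 1) s) c := by
  rw [← addBox_fourRows_two]
  exact h.addBox (.inr hp) (by rw [hc]; simp [fourRows])

theorem row_three (h : IsTableau n (fourRows a p q s) c) (hp : s < q)
    (hc : c n = ((s - 3 : ℤ) : ℂ)) : IsTableau (n + 1) (fourRows a p q (s + 1)) c := by
  rw [← addBox_fourRows_three]
  exact h.addBox (.inr hp) (by rw [hc]; simp [fourRows])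

theorem extend_row_zero {m : ℕ} (h : IsTableau m (fourRows a p q s) c)
    (hc : ∀ k, m ≤ k → c k = ((k + (a - m) : ℤ) : ℂ)) (l : ℕ) :
    IsTableau (m + l) (fourRows (a + l) p q s) c := by
  induction l with
  | zero => exact h
  | succ l ih =>
    refine ih.row_zero ?_
    rw [hc _ (by omega)]
    congr 1
    push_cast
    ring

end IsTableau

/-- The sequence with the given first terms, continued by `k ↦ k + b`. -/
def contents (l : List ℤ) (b : ℤ) (k : ℕ) : ℂ :=
  ((l.getD k (k + b) : ℤ) : ℂ)

theorem contents_of_le {l : List ℤ} {b : ℤ} {k : ℕ} (h : l.length ≤ k) :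
    contents l b k = ((k + b : ℤ) : ℂ) := by
  rw [contents, List.getD_eq_default _ _ h]

open Equiv in
/-- Irreducible degrees from polynomial weight vectors. -/
theorem numTableaux_fourRows_mem_cd {a p q s : ℕ} (P : (ℕ → ℂ) → ℂ) (t : List ℤ) (b : ℤ) (m : ℕ)
    (ht : t.length = m) (hb : b = a - m)
    (hshape : IsTableau m (fourRows a p q s) (contents t b))
    (hP : ∀ y z : ℕ → ℂ, (∀ i < m, y i = z i) → P y = P z)
    (hlt : ∀ k < m, ∀ y, ∑ j ∈ Finset.range k, P (y ∘ swap j k) = contents t b k * P y)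
    (hnew : ∀ y z, ∑ j ∈ Finset.range m, P (Function.update y j z) = (m + b : ℤ) * P y)
    (y : ℕ → Fin 4) (hne : P (fun i => ((y i : ℕ) : ℂ)) ≠ 0) (l : ℕ) :
    numTableaux (m + l) (fourRows (a + l) p q s) ∈ cd (Perm (Fin (m + l))) := by
  subst hb ht
  exact numTableaux_mem_cd (functionRep _) (hshape.extend_row_zero (fun k hk => contents_of_le hk) l)
    (isWeightVector_functionRep P _ _ (by omega) hP hlt hnew (fun k hk => contents_of_le hk) y hne)

open Equiv in
theorem numTableaux_one_mem_cd (l : ℕ) :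
    numTableaux (2 + l) (fourRows (1 + l) 1 0 0) ∈ cd (Perm (Fin (2 + l))) := by
  refine numTableaux_fourRows_mem_cd (fun x => x 0 - x 1) [0, -1] (-1) 2 rfl rfl ?_ ?_ ?_ ?_
    (fun i => if i = 1 then 1 else 0) ?_ l
  · refine .row_one (.row_zero (isTableau_zero _) ?_) ?_ ?_ <;> simp [contents]
  · intro y z h
    simp [h 0, h 1]
  · intro k hk y
    interval_cases k <;> simp [swap_apply_def, contents]
  · intro y z
    simp [Finset.sum_range_succ, Function.update_apply]
    ring
  · simp

open Equiv in
theorem numTableaux_two_mem_cd (l : ℕ) :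
    numTableaux (4 + l) (fourRows (2 + l) 2 0 0) ∈ cd (Perm (Fin (4 + l))) := by
  refine numTableaux_fourRows_mem_cd (fun x => (x 0 - x 1) * (x 2 - x 3)) [0, -1, 1, 0] (-2) 4
    rfl rfl ?_ ?_ ?_ ?_ (fun i => if i = 1 ∨ i = 3 then 1 else 0) ?_ l
  · refine .row_one (.row_zero (.row_one (.row_zero (isTableau_zero _) ?_) ?_ ?_) ?_) ?_ ?_ <;>
      simp [contents]
  · intro y z h
    simp [h 0, h 1, h 2, h 3]
  · intro k hk y
    interval_cases k <;> simp [Finset.sum_range_succ, swap_apply_def, contents] <;> ring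
  · intro y z
    simp [Finset.sum_range_succ, Function.update_apply]
    ring
  · simp

open Equiv in
theorem numTableaux_oneOne_mem_cd (l : ℕ) :
    numTableaux (3 + l) (fourRows (1 + l) 1 1 0) ∈ cd (Perm (Fin (3 + l))) := by
  refine numTableaux_fourRows_mem_cd (fun x => (x 0 - x 1) * (x 0 - x 2) * (x 1 - x 2))
    [0, -1, -2] (-2) 3
    rfl rfl ?_ ?_ ?_ ?_ (fun i => if i = 1 then 1 else if i = 2 then 2 else 0) ?_ l
  · refine .row_two (.row_one (.row_zero (isTableau_zero _) ?_) ?_ ?_) ?_ ?_ <;>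
      simp [contents]
  · intro y z h
    simp [h 0, h 1, h 2]
  · intro k hk y
    interval_cases k <;> simp [Finset.sum_range_succ, swap_apply_def, contents] <;> ring
  · intro y z
    simp [Finset.sum_range_succ, Function.update_apply]
    ring
  · norm_num

open Equiv in
theorem numTableaux_three_mem_cd (l : ℕ) :
    numTableaux (6 + l) (fourRows (3 + l) 3 0 0) ∈ cd (Perm (Fin (6 + l))) := by
  refine numTableaux_fourRows_mem_cd (fun x => (x 0 - x 1) * (x 2 - x 3) * (x 4 - x 5))
    [0, -1, 1, 0, 2, 1] (-3) 6
    rfl rfl ?_ ?_ ?_ ?_ (fun i => if i = 1 ∨ i = 3 ∨ i = 5 then 1 else 0) ?_ l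
  · refine .row_one (.row_zero (.row_one (.row_zero (.row_one (.row_zero (isTableau_zero _)
      ?_) ?_ ?_) ?_) ?_ ?_) ?_) ?_ ?_ <;> simp [contents]
  · intro y z h
    simp [h 0, h 1, h 2, h 3, h 4, h 5]
  · intro k hk y
    interval_cases k <;> simp [Finset.sum_range_succ, swap_apply_def, contents] <;> ring
  · intro y z
    simp [Finset.sum_range_succ, Function.update_apply]
    ring
  · simp

open Equiv in
theorem numTableaux_oneOneOne_mem_cd (l : ℕ) :
    numTableaux (4 + l) (fourRows (1 + l) 1 1 1) ∈ cd (Perm (Fin (4 + l))) := by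
  refine numTableaux_fourRows_mem_cd (fun x => (x 0 - x 1) * (x 0 - x 2) * (x 1 - x 2) *
    ((x 0 - x 3) * (x 1 - x 3) * (x 2 - x 3))) [0, -1, -2, -3] (-3) 4
    rfl rfl ?_ ?_ ?_ ?_
    (fun i => if i = 1 then 1 else if i = 2 then 2 else if i = 3 then 3 else 0) ?_ l
  · refine .row_three (.row_two (.row_one (.row_zero (isTableau_zero _) ?_) ?_ ?_) ?_ ?_) ?_ ?_ <;>
      simp [contents]
  · intro y z h
    simp [h 0, h 1, h 2, h 3]
  · intro k hk y
    interval_cases k <;> simp [Finset.sum_range_succ, swap_apply_def, contents] <;> ring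
  · intro y z
    simp [Finset.sum_range_succ, Function.update_apply]
    ring
  · norm_num

open Equiv in
theorem numTableaux_twoOne_mem_cd (l : ℕ) :
    numTableaux (5 + l) (fourRows (2 + l) 2 1 0) ∈ cd (Perm (Fin (5 + l))) := by
  refine numTableaux_fourRows_mem_cd
    (fun x => (x 0 - x 1) * (x 0 - x 2) * (x 1 - x 2) * (x 3 - x 4)) [0, -1, -2, 1, 0] (-3) 5
    rfl rfl ?_ ?_ ?_ ?_
    (fun i => if i = 1 ∨ i = 4 then 1 else if i = 2 then 2 else 0) ?_ l
  · refine .row_one (.row_zero (.row_two (.row_one (.row_zero (isTableau_zero _)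
      ?_) ?_ ?_) ?_ ?_) ?_) ?_ ?_ <;> simp [contents]
  · intro y z h
    simp [h 0, h 1, h 2, h 3, h 4]
  · intro k hk y
    interval_cases k <;> simp [Finset.sum_range_succ, swap_apply_def, contents] <;> ring
  · intro y z
    simp [Finset.sum_range_succ, Function.update_apply]
    ring
  · norm_num

/-- The sequence of row lengths given by a list. -/
def listRows (k : List ℕ) (i : ℕ) : ℕ := k.getD i 0

/-- Increase the entry at position `i` by one, padding with zeros. -/
def listIncr : List ℕ → ℕ → List ℕ
  | [], 0 => [1]
  | [], i + 1 => 0 :: listIncr [] i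
  | a :: k, 0 => (a + 1) :: k
  | a :: k, i + 1 => a :: listIncr k i

/-- Whether a box can be added at the end of row `i`. -/
def listAddable (k : List ℕ) : ℕ → Bool
  | 0 => Nat.ble (listRows k 1) (listRows k 0)
  | i + 1 => Nat.blt (listRows k (i + 1)) (listRows k i) &&
      Nat.ble (listRows k (i + 2)) (listRows k (i + 1))

/-- Add `v` to the value attached to the key `k` in a list of triples (code, key, value). The codes
only serve to find the key quickly. -/
def tableInsert (c : ℕ) (k : List ℕ) (v : ℕ) : List (ℕ × List ℕ × ℕ) → List (ℕ × List ℕ × ℕ)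
  | [] => [(c, k, v)]
  | e :: l => bif Nat.blt e.1 c then (c, k, v) :: e :: l else
      bif Nat.beq e.1 c && k == e.2.1 then (c, k, v + e.2.2) :: l else e :: tableInsert c k v l

/-- Insert the shapes obtained by adding a box to `k` in one of the first `m` rows. -/
def tableExtend (c : ℕ) (k : List ℕ) (v : ℕ) :
    ℕ → List (ℕ × List ℕ × ℕ) → List (ℕ × List ℕ × ℕ)
  | 0, l => l
  | m + 1, l => tableExtend c k v m
      (bif listAddable k m then tableInsert (c + 32 ^ m) (listIncr k m) v l else l)

/-- The table of the numbers of tableaux of all shapes with `n` boxes. -/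
def tableauxTable : ℕ → List (ℕ × List ℕ × ℕ)
  | 0 => [(0, [], 1)]
  | n + 1 => (tableauxTable n).foldr (fun e l => tableExtend e.1 e.2.1 e.2.2 (n + 1) l) []

open Classical in
/-- The total value attached to the shape `r`. -/
noncomputable def tableValue (l : List (ℕ × List ℕ × ℕ)) (r : ℕ → ℕ) : ℕ :=
  (l.map fun e => if listRows e.2.1 = r then e.2.2 else 0).sum

theorem listRows_listIncr (k : List ℕ) (i : ℕ) : listRows (listIncr k i) = addBox (listRows k) i := by
  funext j
  rw [addBox_apply]
  induction k, i using listIncr.induct generalizing j with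
  | case1 => cases j <;> simp [listIncr, listRows]
  | case2 i ih =>
    cases j with
    | zero => simp [listIncr, listRows]
    | succ j => simpa [listIncr, listRows] using ih j
  | case3 a k => cases j <;> simp [listIncr, listRows]
  | case4 a k i ih =>
    cases j with
    | zero => simp [listIncr, listRows]
    | succ j => simpa [listIncr, listRows] using ih j

theorem listAddable_iff {r : ℕ → ℕ} (hr : Antitone r) (k : List ℕ) (i : ℕ) :
    (listAddable k i = true ∧ listRows (listIncr k i) = r) ↔
      (r (i + 1) < r i ∧ listRows k = removeBox r i) := by
  rw [listRows_listIncr]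
  constructor
  · rintro ⟨h, rfl⟩
    constructor
    · cases i <;> simp [listAddable] at h <;> simp [addBox_apply, add_assoc] <;> omega
    · funext j
      simp [addBox_apply, removeBox_apply]
  · rintro ⟨h, hk⟩
    rw [hk, addBox_removeBox (by omega)]
    have h' : r (i + 1) ≤ r i - 1 := by omega
    refine ⟨?_, rfl⟩
    cases i with
    | zero => simpa [listAddable, hk, removeBox_apply] using h'
    | succ i =>
      have := hr (show i ≤ i + 1 by omega)
      simp [listAddable, hk, removeBox_apply, add_assoc] at h h' ⊢
      omega

open Classical in
theorem tableValue_insert (c : ℕ) (k : List ℕ) (v : ℕ) (l : List (ℕ × List ℕ × ℕ)) (r : ℕ → ℕ) :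
    tableValue (tableInsert c k v l) r = (if listRows k = r then v else 0) + tableValue l r := by
  induction l with
  | nil => simp [tableInsert, tableValue]
  | cons e l ih =>
    rw [tableInsert]
    cases h1 : Nat.blt e.1 c with
    | true => simp [tableValue]
    | false =>
      cases h2 : Nat.beq e.1 c && k == e.2.1 with
      | true =>
        obtain rfl : k = e.2.1 := by simpa using (Bool.and_eq_true_iff.1 h2).2
        simp only [tableValue, cond_true, cond_false, List.map_cons, List.sum_cons]
        split_ifs <;> omega
      | false =>
        simp only [tableValue] at ih
        simp only [tableValue, cond_false, List.map_cons, List.sum_cons, ih]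
        omega

open Classical in
theorem tableValue_extend (c : ℕ) (k : List ℕ) (v m : ℕ) (l : List (ℕ × List ℕ × ℕ))
    {r : ℕ → ℕ} (hr : Antitone r) :
    tableValue (tableExtend c k v m l) r =
      ∑ i ∈ (Finset.range m).filter (fun i => r (i + 1) < r i),
        (if listRows k = removeBox r i then v else 0) + tableValue l r := by
  induction m generalizing l with
  | zero => simp [tableExtend]
  | succ m ih =>
    have h := listAddable_iff hr k m
    rw [tableExtend, ih, Finset.range_add_one, Finset.filter_insert]
    cases h1 : listAddable k m with
    | true =>
      rw [cond_true, tableValue_insert]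
      by_cases h2 : r (m + 1) < r m
      · rw [if_pos h2, Finset.sum_insert (by simp)]
        simp only [h1, h2, true_and] at h
        simp only [h]
        omega
      · rw [if_neg h2, if_neg (fun h3 => h2 (h.1 ⟨h1, h3⟩).1), zero_add]
    | false =>
      rw [cond_false]
      by_cases h2 : r (m + 1) < r m
      · rw [if_pos h2, Finset.sum_insert (by simp), if_neg fun h3 => ?_, zero_add]
        rw [(h.2 ⟨h2, h3⟩).1] at h1
        cases h1
      · rw [if_neg h2]

theorem tableValue_tableauxTable {n : ℕ} {r : ℕ → ℕ} (h : IsShape n r) :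
    tableValue (tableauxTable n) r = numTableaux n r := by
  classical
  induction n generalizing r with
  | zero =>
    obtain rfl : r = listRows [] := funext fun i => (h.2.1 i (Nat.zero_le i)).trans (by simp [listRows])
    simp [tableauxTable, tableValue, numTableaux]
  | succ n ih =>
    have key : ∀ t : List (ℕ × List ℕ × ℕ),
        tableValue (t.foldr (fun e l => tableExtend e.1 e.2.1 e.2.2 (n + 1) l) []) r =
        ∑ i ∈ (Finset.range (n + 1)).filter (fun i => r (i + 1) < r i),
          tableValue t (removeBox r i) := by
      intro t
      induction t with
      | nil => simp [tableValue]
      | cons e t iht =>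
        rw [List.foldr_cons, tableValue_extend _ _ _ _ _ h.1, iht, ← Finset.sum_add_distrib]
        simp [tableValue]
    rw [tableauxTable, key, numTableaux]
    exact Finset.sum_congr rfl fun i hi => ih (h.removeBox (Finset.mem_filter.1 hi).2)

/-- Every shape with `n` boxes occurs in the table, with a lower bound for its number of tableaux. -/
theorem exists_mem_tableauxTable {n : ℕ} {r : ℕ → ℕ} (h : IsShape n r) :
    ∃ e ∈ tableauxTable n, listRows e.2.1 = r ∧ e.2.2 ≤ numTableaux n r := by
  classical
  have hpos := h.numTableaux_pos
  rw [← tableValue_tableauxTable h] at hpos ⊢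
  unfold tableValue at hpos ⊢
  by_contra! hc
  refine hpos.ne' (List.sum_eq_zero fun x hx => ?_)
  obtain ⟨e, he, rfl⟩ := List.mem_map.1 hx
  refine if_neg fun hr => (hc e he hr).not_ge ?_
  refine le_trans ?_ (List.single_le_sum (fun _ _ => Nat.zero_le _) _ hx)
  rw [if_pos hr]

/-- Lower bounds for the table of shapes with `n` boxes, away from the first rows and columns. -/
def tableCheck (n : ℕ) : Bool :=
  (tableauxTable n).all fun e => Nat.ble n (listRows e.2.1 0 + 3) ||
    Nat.blt 0 (listRows e.2.1 (n - 4)) || Nat.blt (n * (n - 2) * (n - 4)) (3 * e.2.2) &&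
      (Nat.ble n (listRows e.2.1 0 + 4) || Nat.blt 0 (listRows e.2.1 (n - 5)) ||
        Nat.blt ((n + 1) * (n - 1) * (n - 3)) (3 * e.2.2))

theorem tableCheck_fifteen : tableCheck 15 = true := by
  decide +kernel

theorem lt_numTableaux_fifteen {r : ℕ → ℕ} (h : IsShape 15 r) (h0 : r 0 < 12) (h1 : r 11 = 0) :
    2145 < 3 * numTableaux 15 r ∧ (r 0 < 11 → r 10 = 0 → 2688 < 3 * numTableaux 15 r) := by
  obtain ⟨e, he, rfl, hle⟩ := exists_mem_tableauxTable h
  have := List.all_eq_true.1 tableCheck_fifteen e he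
  simp only [Bool.or_eq_true, Bool.and_eq_true, Nat.ble_eq, Nat.blt_eq] at this
  norm_num at this
  omega

/-- The column lengths of a diagram with row lengths `r` and at most `M` rows. -/
def conjugateRows (M : ℕ) (r : ℕ → ℕ) (k : ℕ) : ℕ :=
  ((Finset.range M).filter fun j => k < r j).card

theorem lt_conjugateRows_iff_of_antitone {M : ℕ} {r : ℕ → ℕ} (hr : Antitone r) (h0 : ∀ i, M ≤ i → r i = 0)
    (j k : ℕ) : j < conjugateRows M r k ↔ k < r j := by
  constructor
  · intro h
    by_contra hc
    have : (Finset.range M).filter (fun j => k < r j) ⊆ Finset.range j := by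
      intro i hi
      rw [Finset.mem_filter] at hi
      rw [Finset.mem_range]
      by_contra hij
      have := hr (not_lt.1 hij)
      omega
    have := Finset.card_le_card this
    rw [Finset.card_range] at this
    exact absurd h (not_lt.2 this)
  · intro h
    have : Finset.range (j + 1) ⊆ (Finset.range M).filter (fun j => k < r j) := by
      intro i hi
      rw [Finset.mem_range] at hi
      have h1 := hr (show i ≤ j by omega)
      rw [Finset.mem_filter, Finset.mem_range]
      refine ⟨?_, by omega⟩
      by_contra hc
      have := h0 i (by omega)
      omega
    have := Finset.card_le_card this
    rw [Finset.card_range] at this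
    exact this

namespace IsShape

variable {n M : ℕ} {r : ℕ → ℕ}

theorem apply_le (h : IsShape n r) (i : ℕ) : r i ≤ n := by
  rcases lt_or_ge i n with hi | hi
  · conv_rhs => rw [← h.2.2]
    exact Finset.single_le_sum (f := r) (fun _ _ => Nat.zero_le _) (Finset.mem_range.2 hi)
  · rw [h.2.1 i hi]; omega

theorem lt_conjugateRows_iff (h : IsShape n r) (hM : n ≤ M) {j k : ℕ} :
    j < conjugateRows M r k ↔ k < r j :=
  lt_conjugateRows_iff_of_antitone h.1 (fun i hi => h.2.1 i (by omega)) j k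

theorem conjugateRows (h : IsShape n r) (hM : n ≤ M) : IsShape n (conjugateRows M r) := by
  refine of_sum (M := n) (fun i j hij => ?_) (fun i hi => ?_) ?_
  · refine Finset.card_le_card fun k => ?_
    simp only [Finset.mem_filter]
    exact fun hk => ⟨hk.1, by omega⟩
  · refine Finset.card_eq_zero.2 (Finset.filter_eq_empty_iff.2 fun j _ => ?_)
    have := h.apply_le j
    omega
  · conv_rhs => rw [← h.sum_range hM]
    simp only [_root_.conjugateRows, Finset.card_filter]
    rw [Finset.sum_comm]
    refine Finset.sum_congr rfl fun j _ => ?_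
    rw [← Finset.card_filter]
    have : (Finset.range n).filter (fun k => k < r j) = Finset.range (r j) := by
      ext k
      have := h.apply_le j
      simp only [Finset.mem_filter, Finset.mem_range]
      omega
    rw [this, Finset.card_range]

theorem conjugateRows_conjugateRows (h : IsShape n r) (hM : n ≤ M) :
    _root_.conjugateRows M (_root_.conjugateRows M r) = r := by
  funext k
  refine eq_of_forall_lt_iff fun j => ?_
  rw [(h.conjugateRows hM).lt_conjugateRows_iff hM, h.lt_conjugateRows_iff hM]

theorem conjugateRows_removeBox (h : IsShape (n + 1) r) (hM : n + 1 ≤ M) {i : ℕ}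
    (hi : r (i + 1) < r i) :
    _root_.conjugateRows M (_root_.removeBox r i) =
      _root_.removeBox (_root_.conjugateRows M r) (r i - 1) := by
  funext k
  refine eq_of_forall_lt_iff fun j => ?_
  rw [(h.removeBox hi).lt_conjugateRows_iff (by omega), removeBox_apply, removeBox_apply]
  have h1 := h.lt_conjugateRows_iff hM (j := j) (k := k)
  have h2 := h.lt_conjugateRows_iff hM (j := j + 1) (k := k)
  have h3 : i < j → r j ≤ r (i + 1) := fun hij => h.1 hij
  have h4 : j ≤ i → r i ≤ r j := fun hij => h.1 hij
  have h5 : i < j + 1 → r (j + 1) ≤ r (i + 1) := fun hij => h.1 (by omega)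
  have h6 : j + 1 ≤ i → r i ≤ r (j + 1) := fun hij => h.1 hij
  have h7 : j = i → r j = r i := fun h => by rw [h]
  split_ifs <;> omega

theorem conjugateRows_corner (h : IsShape n r) (hM : n ≤ M) {i : ℕ}
    (hi : r (i + 1) < r i) :
    _root_.conjugateRows M r (r i - 1 + 1) < _root_.conjugateRows M r (r i - 1) := by
  have h1 := h.lt_conjugateRows_iff hM (j := i) (k := r i - 1 + 1)
  have h2 := h.lt_conjugateRows_iff hM (j := i) (k := r i - 1)
  omega

theorem corner_injective (h : Antitone r) {i j : ℕ} (hi : r (i + 1) < r i) (hj : r (j + 1) < r j)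
    (hij : r i = r j) : i = j := by
  rcases lt_trichotomy i j with hlt | heq | hlt
  · have := h (show i + 1 ≤ j from hlt); omega
  · exact heq
  · have := h (show j + 1 ≤ i from hlt); omega

theorem numTableaux_le_conjugateRows (h : IsShape n r) (hM : n ≤ M) :
    numTableaux n r ≤ numTableaux n (_root_.conjugateRows M r) := by
  induction n generalizing r with
  | zero => simp [numTableaux]
  | succ n ih =>
    set S := (Finset.range (n + 1)).filter fun i => r (i + 1) < r i with hS
    have hmem : ∀ i ∈ S, r (i + 1) < r i := fun i hi => (Finset.mem_filter.1 hi).2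
    have hinj : Set.InjOn (fun i => r i - 1) S := by
      intro i hi j hj hij
      have h1 := hmem i hi
      have h2 := hmem j hj
      exact corner_injective h.1 h1 h2 (by simp only at hij; omega)
    have h1 := (h.conjugateRows hM).sum_le_numTableaux (S.image fun i => r i - 1) (by
      simp only [Finset.mem_image]
      rintro _ ⟨i, hi, rfl⟩
      exact h.conjugateRows_corner hM (hmem i hi))
    rw [Finset.sum_image hinj] at h1
    refine le_trans ?_ h1
    rw [numTableaux]
    refine Finset.sum_le_sum fun i hi => ?_
    rw [← h.conjugateRows_removeBox hM (hmem i hi)]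
    exact ih (h.removeBox (hmem i hi)) (by omega)

/-- Conjugate shapes have the same number of tableaux. -/
theorem numTableaux_conjugateRows (h : IsShape n r) (hM : n ≤ M) :
    numTableaux n (_root_.conjugateRows M r) = numTableaux n r := by
  refine le_antisymm ?_ (h.numTableaux_le_conjugateRows hM)
  have := (h.conjugateRows hM).numTableaux_le_conjugateRows hM
  rwa [h.conjugateRows_conjugateRows hM] at this

end IsShape

theorem isShape_fourRows {n a p q s : ℕ} (h1 : p ≤ a) (h2 : q ≤ p) (h3 : s ≤ q)
    (hn : a + p + q + s = n) : IsShape n (fourRows a p q s) := by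
  refine IsShape.of_sum (M := 4) (antitone_nat_of_succ_le fun i => ?_) (fun i hi => ?_) ?_
  · match i with
    | 0 => exact h1
    | 1 => exact h2
    | 2 => exact h3
    | 3 => exact Nat.zero_le _
    | i + 4 => exact le_rfl
  · match i, hi with
    | i + 4, _ => rfl
  · simp [Finset.sum_range_succ, fourRows, hn]

/-- The branching rule for shapes with at most four rows. -/
theorem numTableaux_fourRows_succ {n a p q s : ℕ} (h1 : p ≤ a) (h2 : q ≤ p) (h3 : s ≤ q)
    (hn : a + p + q + s = n + 1) :
    numTableaux (n + 1) (fourRows a p q s) =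
      (if p < a then numTableaux n (fourRows (a - 1) p q s) else 0) +
      (if q < p then numTableaux n (fourRows a (p - 1) q s) else 0) +
      (if s < q then numTableaux n (fourRows a p (q - 1) s) else 0) +
      (if 0 < s then numTableaux n (fourRows a p q (s - 1)) else 0) := by
  have h := isShape_fourRows h1 h2 h3 hn
  rw [h.numTableaux_eq ((Finset.range 4).filter fun i =>
    fourRows a p q s (i + 1) < fourRows a p q s i)]
  · rw [Finset.sum_filter]
    have e0 : removeBox (fourRows a p q s) 0 = fourRows (a - 1) p q s := by
      funext i; match i with | 0 | 1 | 2 | 3 | i + 4 => simp [removeBox_apply, fourRows]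
    have e1 : removeBox (fourRows a p q s) 1 = fourRows a (p - 1) q s := by
      funext i; match i with | 0 | 1 | 2 | 3 | i + 4 => simp [removeBox_apply, fourRows]
    have e2 : removeBox (fourRows a p q s) 2 = fourRows a p (q - 1) s := by
      funext i; match i with | 0 | 1 | 2 | 3 | i + 4 => simp [removeBox_apply, fourRows]
    have e3 : removeBox (fourRows a p q s) 3 = fourRows a p q (s - 1) := by
      funext i; match i with | 0 | 1 | 2 | 3 | i + 4 => simp [removeBox_apply, fourRows]
    simp only [Finset.sum_range_succ, Finset.sum_range_zero, e0, e1, e2, e3, zero_add]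
    rfl
  · intro i
    rw [Finset.mem_filter, and_iff_right_iff_imp, Finset.mem_range]
    intro hi
    match i, hi with
    | 0, _ | 1, _ | 2, _ | 3, _ => omega

theorem numTableaux_fourRows_zero (a : ℕ) : numTableaux a (fourRows a 0 0 0) = 1 := by
  induction a with
  | zero => rfl
  | succ a ih => rw [numTableaux_fourRows_succ] <;> simp [ih]

theorem numTableaux_fourRows_one (a : ℕ) :
    numTableaux (a + 2) (fourRows (a + 1) 1 0 0) = a + 1 := by
  induction a with
  | zero => rw [numTableaux_fourRows_succ] <;> simp [numTableaux_fourRows_zero]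
  | succ a ih => rw [numTableaux_fourRows_succ] <;> simp [ih, numTableaux_fourRows_zero]

theorem numTableaux_fourRows_two (a : ℕ) :
    2 * numTableaux (a + 4) (fourRows (a + 2) 2 0 0) = (a + 4) * (a + 1) := by
  induction a with
  | zero =>
    have := numTableaux_fourRows_one 1
    rw [numTableaux_fourRows_succ] <;> simp_all
  | succ a ih =>
    have := numTableaux_fourRows_one (a + 2)
    rw [numTableaux_fourRows_succ] <;> simp_all
    linarith

theorem numTableaux_fourRows_oneOne (a : ℕ) :
    2 * numTableaux (a + 3) (fourRows (a + 1) 1 1 0) = (a + 2) * (a + 1) := by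
  induction a with
  | zero =>
    have := numTableaux_fourRows_one 0
    rw [numTableaux_fourRows_succ] <;> simp_all
  | succ a ih =>
    have := numTableaux_fourRows_one (a + 1)
    rw [numTableaux_fourRows_succ] <;> simp_all
    linarith

theorem numTableaux_fourRows_three (a : ℕ) :
    6 * numTableaux (a + 6) (fourRows (a + 3) 3 0 0) = (a + 6) * (a + 5) * (a + 1) := by
  induction a with
  | zero =>
    have := numTableaux_fourRows_two 1
    rw [numTableaux_fourRows_succ] <;> simp_all
    linarith
  | succ a ih =>
    have := numTableaux_fourRows_two (a + 2)
    rw [numTableaux_fourRows_succ] <;> simp_all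
    linarith

theorem numTableaux_fourRows_twoOne (a : ℕ) :
    3 * numTableaux (a + 5) (fourRows (a + 2) 2 1 0) = (a + 5) * (a + 3) * (a + 1) := by
  induction a with
  | zero =>
    have := numTableaux_fourRows_two 0
    have := numTableaux_fourRows_oneOne 1
    rw [numTableaux_fourRows_succ] <;> simp_all
    linarith
  | succ a ih =>
    have := numTableaux_fourRows_two (a + 1)
    have := numTableaux_fourRows_oneOne (a + 2)
    rw [numTableaux_fourRows_succ] <;> simp_all
    linarith

theorem numTableaux_fourRows_oneOneOne (a : ℕ) :
    6 * numTableaux (a + 4) (fourRows (a + 1) 1 1 1) = (a + 3) * (a + 2) * (a + 1) := by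
  induction a with
  | zero =>
    have := numTableaux_fourRows_oneOne 0
    rw [numTableaux_fourRows_succ] <;> simp_all
  | succ a ih =>
    have := numTableaux_fourRows_oneOne (a + 1)
    rw [numTableaux_fourRows_succ] <;> simp_all
    linarith

/-- The shapes with at most three boxes outside the first row. -/
theorem IsShape.eq_fourRows {n : ℕ} {r : ℕ → ℕ} (h : IsShape n r) (h0 : n ≤ r 0 + 3) :
    r = fourRows (r 0) (r 1) (r 2) (r 3) ∧ r 0 + r 1 + r 2 + r 3 = n := by
  have hs := h.sum_range (M := n + 5) (by omega)
  have h4 : ∑ i ∈ Finset.range 5, r i ≤ ∑ i ∈ Finset.range (n + 5), r i :=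
    Finset.sum_le_sum_of_subset (by simp)
  have a1 : r 1 ≤ r 0 := h.1 (by omega)
  have a2 : r 2 ≤ r 1 := h.1 (by omega)
  have a3 : r 3 ≤ r 2 := h.1 (by omega)
  have a4 : r 4 ≤ r 3 := h.1 (by omega)
  rw [hs] at h4
  simp only [Finset.sum_range_succ, Finset.sum_range_zero, zero_add] at h4
  have hz : ∀ i, 4 ≤ i → r i = 0 := fun i hi => by
    have := h.1 hi
    omega
  refine ⟨?_, ?_⟩
  · funext i
    match i with
    | 0 | 1 | 2 | 3 => rfl
    | i + 4 => exact hz _ (by omega)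
  · have : ∑ i ∈ Finset.range (n + 5), r i = ∑ i ∈ Finset.range 4, r i := by
      refine (Finset.sum_subset (by simp) fun i _ hi => hz i ?_).symm
      simpa using hi
    rw [hs] at this
    simp only [Finset.sum_range_succ, Finset.sum_range_zero, zero_add] at this
    omega

/-- The small irreducible character degrees of the symmetric group on `n` letters. -/
def smallDegrees (n : ℕ) : List ℕ :=
  [1, n - 1, n * (n - 3) / 2, (n - 1) * (n - 2) / 2, n * (n - 1) * (n - 5) / 6,
    (n - 1) * (n - 2) * (n - 3) / 6, n * (n - 2) * (n - 4) / 3]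

theorem numTableaux_fourRows_two_eq (b : ℕ) :
    numTableaux (b + 4) (fourRows (b + 2) 2 0 0) = (b + 4) * (b + 4 - 3) / 2 := by
  have := numTableaux_fourRows_two b
  rw [show b + 4 - 3 = b + 1 by omega]
  omega

theorem numTableaux_fourRows_oneOne_eq (b : ℕ) :
    numTableaux (b + 3) (fourRows (b + 1) 1 1 0) = (b + 3 - 1) * (b + 3 - 2) / 2 := by
  have := numTableaux_fourRows_oneOne b
  rw [show b + 3 - 1 = b + 2 by omega, show b + 3 - 2 = b + 1 by omega]
  omega

theorem numTableaux_fourRows_three_eq (b : ℕ) :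
    numTableaux (b + 6) (fourRows (b + 3) 3 0 0) = (b + 6) * (b + 6 - 1) * (b + 6 - 5) / 6 := by
  have := numTableaux_fourRows_three b
  rw [show b + 6 - 1 = b + 5 by omega, show b + 6 - 5 = b + 1 by omega]
  omega

theorem numTableaux_fourRows_oneOneOne_eq (b : ℕ) :
    numTableaux (b + 4) (fourRows (b + 1) 1 1 1) =
      (b + 4 - 1) * (b + 4 - 2) * (b + 4 - 3) / 6 := by
  have := numTableaux_fourRows_oneOneOne b
  rw [show b + 4 - 1 = b + 3 by omega, show b + 4 - 2 = b + 2 by omega,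
    show b + 4 - 3 = b + 1 by omega]
  omega

theorem numTableaux_fourRows_twoOne_eq (b : ℕ) :
    numTableaux (b + 5) (fourRows (b + 2) 2 1 0) = (b + 5) * (b + 5 - 2) * (b + 5 - 4) / 3 := by
  have := numTableaux_fourRows_twoOne b
  rw [show b + 5 - 2 = b + 3 by omega, show b + 5 - 4 = b + 1 by omega]
  omega

theorem IsShape.numTableaux_mem_smallDegrees {n : ℕ} {r : ℕ → ℕ} (h : IsShape n r) (hn : 6 ≤ n)
    (h0 : n ≤ r 0 + 3) : numTableaux n r ∈ smallDegrees n ∧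
      (n = r 0 + 3 → n * (n - 1) * (n - 5) ≤ 6 * numTableaux n r) := by
  obtain ⟨hr, hs⟩ := h.eq_fourRows h0
  have h2 : r 2 ≤ r 1 := h.1 (by omega)
  have h3 : r 3 ≤ r 2 := h.1 (by omega)
  rw [hr]
  change _ ∧ (n = r 0 + 3 → _)
  generalize r 0 = a at *
  generalize r 1 = p at *
  generalize r 2 = q at *
  generalize r 3 = s at *
  have : (p = 0 ∧ q = 0 ∧ s = 0) ∨ (p = 1 ∧ q = 0 ∧ s = 0) ∨ (p = 2 ∧ q = 0 ∧ s = 0) ∨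
      (p = 1 ∧ q = 1 ∧ s = 0) ∨ (p = 3 ∧ q = 0 ∧ s = 0) ∨ (p = 2 ∧ q = 1 ∧ s = 0) ∨
      (p = 1 ∧ q = 1 ∧ s = 1) := by omega
  rcases this with ⟨rfl, rfl, rfl⟩ | ⟨rfl, rfl, rfl⟩ | ⟨rfl, rfl, rfl⟩ | ⟨rfl, rfl, rfl⟩ |
    ⟨rfl, rfl, rfl⟩ | ⟨rfl, rfl, rfl⟩ | ⟨rfl, rfl, rfl⟩
  · obtain rfl : a = n := by omega
    exact ⟨by simp [smallDegrees, numTableaux_fourRows_zero], fun h => by omega⟩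
  · obtain ⟨b, rfl⟩ : ∃ b, a = b + 1 := ⟨a - 1, by omega⟩
    obtain rfl : b + 2 = n := by omega
    exact ⟨by simp [smallDegrees, numTableaux_fourRows_one], fun h => by omega⟩
  · obtain ⟨b, rfl⟩ : ∃ b, a = b + 2 := ⟨a - 2, by omega⟩
    obtain rfl : b + 4 = n := by omega
    refine ⟨?_, fun h => by omega⟩
    simp only [smallDegrees, List.mem_cons, numTableaux_fourRows_two_eq, true_or, or_true]
  · obtain ⟨b, rfl⟩ : ∃ b, a = b + 1 := ⟨a - 1, by omega⟩
    obtain rfl : b + 3 = n := by omega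
    refine ⟨?_, fun h => by omega⟩
    simp only [smallDegrees, List.mem_cons, numTableaux_fourRows_oneOne_eq, true_or, or_true]
  · obtain ⟨b, rfl⟩ : ∃ b, a = b + 3 := ⟨a - 3, by omega⟩
    obtain rfl : b + 6 = n := by omega
    refine ⟨?_, fun _ => ?_⟩
    · simp only [smallDegrees, List.mem_cons, numTableaux_fourRows_three_eq, true_or, or_true]
    · rw [numTableaux_fourRows_three, show b + 6 - 1 = b + 5 by omega,
        show b + 6 - 5 = b + 1 by omega]
  · obtain ⟨b, rfl⟩ : ∃ b, a = b + 2 := ⟨a - 2, by omega⟩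
    obtain rfl : b + 5 = n := by omega
    have hf := numTableaux_fourRows_twoOne b
    refine ⟨?_, fun _ => ?_⟩
    · simp only [smallDegrees, List.mem_cons, numTableaux_fourRows_twoOne_eq, true_or, or_true]
    · rw [show b + 5 - 1 = b + 4 by omega, show b + 5 - 5 = b by omega]
      nlinarith
  · obtain ⟨b, rfl⟩ : ∃ b, a = b + 1 := ⟨a - 1, by omega⟩
    obtain rfl : b + 4 = n := by omega
    refine ⟨?_, fun _ => ?_⟩
    · simp only [smallDegrees, List.mem_cons, numTableaux_fourRows_oneOneOne_eq, true_or, or_true]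
    · rw [numTableaux_fourRows_oneOneOne]
      obtain ⟨e, rfl⟩ : ∃ e, b = e + 1 := ⟨b - 1, by omega⟩
      rw [show e + 1 + 4 - 1 = e + 4 by omega, show e + 1 + 4 - 5 = e by omega]
      nlinarith

namespace IsShape

variable {n : ℕ} {r : ℕ → ℕ}

theorem add_mul_le (h : IsShape n r) (i : ℕ) : r 0 + i * r i ≤ n := by
  rw [← h.sum_range (M := n + i + 1) (by omega)]
  calc r 0 + i * r i = ∑ _j ∈ Finset.range i, r i + r 0 := by simp [add_comm]
    _ ≤ ∑ j ∈ Finset.range i, r (j + 1) + r 0 := by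
      gcongr with j hj
      exact h.1 (by simpa using hj)
    _ = ∑ j ∈ Finset.range (i + 1), r j := (Finset.sum_range_succ' r i).symm
    _ ≤ _ := Finset.sum_le_sum_of_subset (by simp)

theorem le_mul (h : IsShape n r) {i : ℕ} (hi : r i = 0) : n ≤ i * r 0 := by
  rw [← h.sum_range (M := n + i) (by omega)]
  have : ∑ j ∈ Finset.range (n + i), r j = ∑ j ∈ Finset.range i, r j := by
    refine (Finset.sum_subset (by simp) fun j _ hj => ?_).symm
    have := h.1 (show i ≤ j by simpa using hj)
    omega
  rw [this]
  calc ∑ j ∈ Finset.range i, r j ≤ ∑ _j ∈ Finset.range i, r 0 :=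
        Finset.sum_le_sum fun j _ => h.1 (Nat.zero_le j)
    _ = i * r 0 := by simp

theorem exists_corner_ge (h : IsShape n r) {i : ℕ} (hi : 0 < r i) :
    ∃ j, i ≤ j ∧ r j = r i ∧ r (j + 1) < r j := by
  by_contra! hc
  have : ∀ k, r (i + k) = r i := by
    intro k
    induction k with
    | zero => rfl
    | succ k ih =>
      have h1 := hc (i + k) (by omega) ih
      have h2 : r (i + k + 1) ≤ r (i + k) := h.1 (by omega)
      rw [← add_assoc]
      omega
  have h1 := this n
  rw [h.2.1 (i + n) (by omega)] at h1
  omega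

theorem numTableaux_removeBox_le (h : IsShape (n + 1) r) {i : ℕ} (hi : r (i + 1) < r i) :
    numTableaux n (_root_.removeBox r i) ≤ numTableaux (n + 1) r := by
  have := h.sum_le_numTableaux {i} (by simpa using hi)
  rwa [Finset.sum_singleton] at this

theorem numTableaux_removeBox_add_le (h : IsShape (n + 1) r) {i j : ℕ} (hij : i ≠ j)
    (hi : r (i + 1) < r i) (hj : r (j + 1) < r j) :
    numTableaux n (_root_.removeBox r i) + numTableaux n (_root_.removeBox r j) ≤
      numTableaux (n + 1) r := by
  have := h.sum_le_numTableaux {i, j} (by simp [hi, hj])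
  rwa [Finset.sum_pair hij] at this

end IsShape

theorem removeBox_le (r : ℕ → ℕ) (i j : ℕ) : removeBox r i j ≤ r j := by
  rw [removeBox_apply]; omega

/-- The lower bound for shapes with `m + 4` boxes and at most `m` rows and `m` columns. -/
def FarBound (m : ℕ) : Prop :=
  ∀ r, IsShape (m + 4) r → r 0 ≤ m → r m = 0 →
    (m + 4) * (m + 2) * m < 3 * numTableaux (m + 4) r

theorem farBound_eleven : FarBound 11 := fun _ h h0 h1 =>
  (lt_numTableaux_fifteen h (by omega) h1).1

theorem FarBound.of_row_zero {m : ℕ} (hm : 11 ≤ m) (H : FarBound m) {r : ℕ → ℕ}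
    (h : IsShape (m + 5) r) (h0 : r 0 = m + 1) :
    (m + 5) * (m + 3) * (m + 1) < 3 * numTableaux (m + 5) r := by
  have h1 := h.add_mul_le 1
  have h2 : r m = 0 := by
    by_contra hc
    have := h.add_mul_le m
    have : m * 1 ≤ m * r m := Nat.mul_le_mul_left _ (by omega)
    omega
  have hc0 : r (0 + 1) < r 0 := by rw [zero_add]; omega
  have h3 : 0 < r 1 := by
    by_contra hc
    have := h.le_mul (i := 1) (by omega)
    omega
  obtain ⟨j, hj, -, hcj⟩ := h.exists_corner_ge h3
  have h4 := h.numTableaux_removeBox_add_le (show 0 ≠ j by omega) hc0 hcj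
  have h5 := H _ (h.removeBox hc0) (by rw [removeBox_apply]; simp [h0])
    (Nat.le_zero.1 ((removeBox_le _ _ _).trans h2.le))
  have hz : removeBox r j 0 = m + 1 := by rw [removeBox_apply, if_neg (by omega), h0]; rfl
  have h6 := ((h.removeBox hcj).numTableaux_mem_smallDegrees (by omega) (by omega)).2 (by omega)
  obtain ⟨e, rfl⟩ : ∃ e, m = e + 11 := ⟨m - 11, by omega⟩
  rw [show e + 11 + 4 - 1 = e + 14 by omega, show e + 11 + 4 - 5 = e + 10 by omega] at h6
  nlinarith [Nat.zero_le (e ^ 3), Nat.zero_le (e ^ 2)]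

theorem FarBound.succ {m : ℕ} (hm : 11 ≤ m) (H : FarBound m)
    (H' : m = 11 ∨ FarBound (m - 1)) : FarBound (m + 1) := by
  intro r h h0 hr
  change IsShape (m + 5) r at h
  change (m + 5) * (m + 3) * (m + 1) < 3 * numTableaux (m + 5) r
  rcases h0.eq_or_lt with h0 | h0
  · exact H.of_row_zero hm h h0
  rcases Nat.eq_zero_or_pos (r m) with hrm | hrm
  swap
  · rw [← h.numTableaux_conjugateRows le_rfl]
    refine H.of_row_zero hm (h.conjugateRows le_rfl) ?_
    have h1 := h.lt_conjugateRows_iff le_rfl (j := m) (k := 0)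
    have h2 := h.lt_conjugateRows_iff le_rfl (j := m + 1) (k := 0)
    omega
  have hpos : 0 < r 0 := by
    by_contra hc
    have := h.le_mul (i := 0) (by omega)
    omega
  have hfar : ∀ i, r (i + 1) < r i →
      (m + 4) * (m + 2) * m < 3 * numTableaux (m + 4) (removeBox r i) := fun i hi =>
    H _ (h.removeBox hi) ((removeBox_le _ _ _).trans (by omega))
      (Nat.le_zero.1 ((removeBox_le _ _ _).trans hrm.le))
  obtain ⟨i, -, hi0, hi⟩ := h.exists_corner_ge hpos
  rcases Nat.eq_zero_or_pos (r (i + 1)) with hi1 | hi1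
  swap
  · obtain ⟨j, hj, -, hcj⟩ := h.exists_corner_ge hi1
    have h1 := h.numTableaux_removeBox_add_le (show i ≠ j by omega) hi hcj
    have h2 := hfar i hi
    have h3 := hfar j hcj
    obtain ⟨e, rfl⟩ : ∃ e, m = e + 11 := ⟨m - 11, by omega⟩
    nlinarith [Nat.zero_le (e ^ 3), Nat.zero_le (e ^ 2)]
  have him : i < m := by
    by_contra hc
    have := h.1 (not_lt.1 hc)
    omega
  have hle := h.le_mul hi1
  have hge := h.add_mul_le i
  rw [hi0] at hge
  obtain ⟨i, rfl⟩ : ∃ i', i = i' + 1 := by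
    refine ⟨i - 1, ?_⟩
    by_contra hc
    obtain rfl : i = 0 := by omega
    omega
  obtain ⟨b, hb⟩ : ∃ b, r 0 = b + 2 := by
    refine ⟨r 0 - 2, ?_⟩
    by_contra hc
    have : r 0 = 1 := by omega
    rw [this] at hle
    omega
  rw [hb] at hge hle hi0
  have hb' : 2 * (b + 2) ≤ m + 5 := by nlinarith
  have hi' : 2 * (i + 2) ≤ m + 5 := by nlinarith
  have hs := h.removeBox hi
  have hle1 := h.numTableaux_removeBox_le hi
  rcases H' with rfl | H'
  · have := (lt_numTableaux_fifteen hs ((removeBox_le _ _ _).trans_lt (by omega))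
      (Nat.le_zero.1 ((removeBox_le _ _ _).trans hrm.le))).2
      ((removeBox_le _ _ _).trans_lt (by omega))
      (Nat.le_zero.1 ((removeBox_le _ _ _).trans (hi1 ▸ h.1 (by omega))))
    change numTableaux 15 _ ≤ numTableaux 16 r at hle1
    change _ < 3 * numTableaux 16 r
    omega
  obtain ⟨m, rfl⟩ : ∃ m', m = m' + 1 := ⟨m - 1, by omega⟩
  have hri : r i = b + 2 := by
    have h1 : r (i + 1) ≤ r i := h.1 (by omega)
    have h2 := h.1 (Nat.zero_le i)
    omega
  have hc1 : removeBox r (i + 1) (i + 1 + 1) < removeBox r (i + 1) (i + 1) := by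
    simp [removeBox_apply, hi1, hi0]
  have hc2 : removeBox r (i + 1) (i + 1) < removeBox r (i + 1) i := by
    simp [removeBox_apply, hri, hi0]
  have hle2 := hs.numTableaux_removeBox_add_le (show i + 1 ≠ i by omega) hc1 hc2
  have hfar' : ∀ j, removeBox r (i + 1) (j + 1) < removeBox r (i + 1) j →
      (m + 4) * (m + 2) * m < 3 * numTableaux (m + 4) (removeBox (removeBox r (i + 1)) j) :=
    fun j hj => H' _ (hs.removeBox hj)
      (((removeBox_le _ _ _).trans (removeBox_le _ _ _)).trans (by omega))
      (Nat.le_zero.1 (((removeBox_le _ _ _).trans (removeBox_le _ _ _)).trans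
        (hi1 ▸ h.1 (by omega))))
  have h2 := hfar' _ hc1
  have h3 := hfar' _ hc2
  obtain ⟨e, rfl⟩ : ∃ e, m = e + 10 := ⟨m - 10, by omega⟩
  change _ ≤ numTableaux (e + 10 + 5) _ at hle2
  change numTableaux (e + 10 + 5) _ ≤ _ at hle1
  change _ < 3 * numTableaux (e + 10 + 1 + 5) r
  change _ ≤ numTableaux (e + 10 + 1 + 5) r at hle1
  nlinarith [Nat.zero_le (e ^ 3), Nat.zero_le (e ^ 2)]

theorem farBound {m : ℕ} (hm : 11 ≤ m) : FarBound m := by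
  induction m using Nat.strong_induction_on with
  | _ m ih =>
    rcases hm.eq_or_lt with rfl | hm
    · exact farBound_eleven
    · obtain ⟨m, rfl⟩ : ∃ m', m = m' + 1 := ⟨m - 1, by omega⟩
      refine (ih m (by omega) (by omega)).succ (by omega) ?_
      by_cases h : m = 11
      · exact .inl h
      · exact .inr (ih (m - 1) (by omega) (by omega))

/-- The number of tableaux of a shape is one of the small degrees or exceeds all of them. -/
theorem IsShape.numTableaux_mem_or_lt {n : ℕ} (hn : 15 ≤ n) {r : ℕ → ℕ} (h : IsShape n r) :
    numTableaux n r ∈ smallDegrees n ∨ n * (n - 2) * (n - 4) / 3 < numTableaux n r := by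
  by_cases h0 : n ≤ r 0 + 3
  · exact .inl (h.numTableaux_mem_smallDegrees (by omega) h0).1
  rcases Nat.eq_zero_or_pos (r (n - 4)) with h1 | h1
  · obtain ⟨m, rfl⟩ : ∃ m, n = m + 4 := ⟨n - 4, by omega⟩
    have := farBound (by omega) r h (by omega) h1
    rw [show m + 4 - 2 = m + 2 by omega, show m + 4 - 4 = m by omega]
    omega
  · rw [← h.numTableaux_conjugateRows le_rfl]
    refine .inl ((h.conjugateRows le_rfl).numTableaux_mem_smallDegrees (by omega) ?_).1
    have := (h.lt_conjugateRows_iff le_rfl (j := n - 4) (k := 0)).2 h1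
    omega

theorem Nat.nth_eq_getElem {p : ℕ → Prop} {l : List ℕ} (hl : l.Pairwise (· < ·))
    (h : ∀ x ∈ l, p x) (h' : ∀ x, p x → x ∈ l ∨ ∀ y ∈ l, y < x) {i : ℕ} (hi : i < l.length) :
    Nat.nth p i = l[i] := by
  classical
  have hset : (Finset.range l[i]).filter p = (l.take i).toFinset := by
    ext x
    rw [Finset.mem_filter, Finset.mem_range, List.mem_toFinset, List.mem_take_iff_getElem]
    constructor
    · rintro ⟨hx, hpx⟩
      rcases h' x hpx with hxl | hxl
      · obtain ⟨j, hj, rfl⟩ := List.getElem_of_mem hxl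
        refine ⟨j, ?_, rfl⟩
        have : j < i := by
          by_contra hc
          rcases (not_lt.1 hc).eq_or_lt with rfl | hlt
          · exact absurd hx (lt_irrefl _)
          · exact absurd hx (List.pairwise_iff_getElem.1 hl i j hi hj hlt).not_gt
        omega
      · exact absurd hx (hxl _ (List.getElem_mem hi)).not_gt
    · rintro ⟨j, hj, rfl⟩
      exact ⟨List.pairwise_iff_getElem.1 hl j i _ hi (by omega), h _ (List.getElem_mem _)⟩
  have hcount : Nat.count p l[i] = i := by
    rw [Nat.count_eq_card_filter_range, hset, List.toFinset_card_of_nodup, List.length_take]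
    · omega
    · exact (hl.imp fun h => h.ne).sublist (List.take_sublist _ _)
  conv_lhs => rw [← hcount]
  exact Nat.nth_count (h _ (List.getElem_mem hi))

theorem smallDegrees_pairwise {n : ℕ} (hn : 15 ≤ n) : (smallDegrees n).Pairwise (· < ·) := by
  obtain ⟨m, rfl⟩ : ∃ m, n = m + 15 := ⟨n - 15, by omega⟩
  rw [smallDegrees, show m + 15 - 1 = m + 14 by omega, show m + 15 - 2 = m + 13 by omega,
    show m + 15 - 3 = m + 12 by omega, show m + 15 - 4 = m + 11 by omega,
    show m + 15 - 5 = m + 10 by omega]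
  have h1 : 2 * (m + 14) + 2 ≤ (m + 15) * (m + 12) := by nlinarith
  have h2 : (m + 15) * (m + 12) + 2 ≤ (m + 14) * (m + 13) := by nlinarith
  have h3 : 3 * ((m + 14) * (m + 13)) + 12 ≤ (m + 15) * (m + 14) * (m + 10) := by
    nlinarith [Nat.zero_le (m ^ 3)]
  have h4 : (m + 15) * (m + 14) * (m + 10) + 6 ≤ (m + 14) * (m + 13) * (m + 12) := by
    nlinarith [Nat.zero_le (m ^ 3)]
  have h5 : (m + 14) * (m + 13) * (m + 12) + 6 ≤ 2 * ((m + 15) * (m + 13) * (m + 11)) := by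
    nlinarith [Nat.zero_le (m ^ 3)]
  simp only [← List.isChain_iff_pairwise, List.isChain_cons_cons, List.isChain_singleton, and_true]
  omega

theorem mem_cd_of_mem_smallDegrees {n : ℕ} (hn : 15 ≤ n) {d : ℕ} (hd : d ∈ (smallDegrees n).tail) :
    d ∈ cd (Equiv.Perm (Fin n)) := by
  simp only [smallDegrees, List.tail_cons, List.mem_cons, List.not_mem_nil, or_false] at hd
  rcases hd with rfl | rfl | rfl | rfl | rfl | rfl
  · obtain ⟨l, rfl⟩ : ∃ l, n = l + 2 := ⟨n - 2, by omega⟩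
    have := numTableaux_one_mem_cd l
    rwa [add_comm 2 l, add_comm 1 l, numTableaux_fourRows_one] at this
  · obtain ⟨l, rfl⟩ : ∃ l, n = l + 4 := ⟨n - 4, by omega⟩
    have := numTableaux_two_mem_cd l
    rwa [add_comm 4 l, add_comm 2 l, numTableaux_fourRows_two_eq] at this
  · obtain ⟨l, rfl⟩ : ∃ l, n = l + 3 := ⟨n - 3, by omega⟩
    have := numTableaux_oneOne_mem_cd l
    rwa [add_comm 3 l, add_comm 1 l, numTableaux_fourRows_oneOne_eq] at this
  · obtain ⟨l, rfl⟩ : ∃ l, n = l + 6 := ⟨n - 6, by omega⟩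
    have := numTableaux_three_mem_cd l
    rwa [add_comm 6 l, add_comm 3 l, numTableaux_fourRows_three_eq] at this
  · obtain ⟨l, rfl⟩ : ∃ l, n = l + 4 := ⟨n - 4, by omega⟩
    have := numTableaux_oneOneOne_mem_cd l
    rwa [add_comm 4 l, add_comm 1 l, numTableaux_fourRows_oneOneOne_eq] at this
  · obtain ⟨l, rfl⟩ : ∃ l, n = l + 5 := ⟨n - 5, by omega⟩
    have := numTableaux_twoOne_mem_cd l
    rwa [add_comm 5 l, add_comm 2 l, numTableaux_fourRows_twoOne_eq] at this

theorem dDeg_eq_getElem {n : ℕ} (hn : 15 ≤ n) {i : ℕ} (hi : i < (smallDegrees n).tail.length) :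
    dDeg (Equiv.Perm (Fin n)) (i + 1) = (smallDegrees n).tail[i] := by
  have hp := smallDegrees_pairwise hn
  have hone : ∀ x ∈ (smallDegrees n).tail, 1 < x := (List.pairwise_cons.1 hp).1
  have hmax : ∀ y ∈ (smallDegrees n).tail, y ≤ n * (n - 2) * (n - 4) / 3 := by
    simp only [smallDegrees, List.pairwise_cons, List.mem_cons, List.tail_cons, forall_eq_or_imp,
      List.not_mem_nil, false_imp_iff, implies_true, and_true] at hp ⊢
    omega
  refine Nat.nth_eq_getElem hp.tail (fun x hx => ?_) (fun x hx => ?_) hi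
  · exact ⟨mem_cd_of_mem_smallDegrees hn hx, (hone x hx).ne'⟩
  · obtain ⟨hx, hx1⟩ := hx
    obtain ⟨r, hr, rfl⟩ := exists_isShape_of_mem_cd hx
    rcases hr.numTableaux_mem_or_lt hn with h | h
    · exact .inl ((List.mem_cons.1 h).resolve_left hx1)
    · exact .inr fun y hy => (hmax y hy).trans_lt h

theorem stmt8 (n : ℕ) (hn : 15 ≤ n) :
    dDeg (Equiv.Perm (Fin n)) 1 = n - 1 ∧
    dDeg (Equiv.Perm (Fin n)) 2 = n * (n - 3) / 2 ∧
    dDeg (Equiv.Perm (Fin n)) 3 = (n - 1) * (n - 2) / 2 ∧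
    dDeg (Equiv.Perm (Fin n)) 4 = n * (n - 1) * (n - 5) / 6 ∧
    dDeg (Equiv.Perm (Fin n)) 5 = (n - 1) * (n - 2) * (n - 3) / 6 ∧
    dDeg (Equiv.Perm (Fin n)) 6 = n * (n - 2) * (n - 4) / 3 := by
  have hl : (smallDegrees n).tail.length = 6 := rfl
  exact ⟨dDeg_eq_getElem hn (i := 0) (by omega), dDeg_eq_getElem hn (i := 1) (by omega),
    dDeg_eq_getElem hn (i := 2) (by omega), dDeg_eq_getElem hn (i := 3) (by omega),
    dDeg_eq_getElem hn (i := 4) (by omega), dDeg_eq_getElem hn (i := 5) (by omega)⟩
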